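/- arXiv:2009.05022 — 2 statements merged into one kernel-verified Lean document; each statement's English description precedes it below -/
import Mathlib

section
/- Let k be a field and let t ≤ min{p,q} be positive integers. Let X = (x_{ij}) be a p×q matrix of indeterminates, R = k[x_{ij}] the polynomial ring with maximal homogeneous ideal 𝔪, and I = I_t(X) the ideal generated by the determinants of all t×t submatrices of X. Set h = (p−t+1)(q−t+1). Then for all integers m, r, c ≥ 1 one has the containment I^{(r(m+h−1)−h+c)} ⊆ 𝔪^{(r−1)(h−1)+c−1} · (I^{(m)})^r. -/
/-- The `n`-th symbolic power of an ideal `I`: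
`f ∈ I^{(n)}` iff for every associated prime `P` of `R/I` there is `s ∉ P` with `s*f ∈ I^n`.
(For a prime ideal `I` this is exactly `{f | ∃ s ∉ I, s*f ∈ I^n} = Iⁿ R_I ∩ R`.) -/
def symbolicPower {R : Type*} [CommRing R] (I : Ideal R) (n : ℕ) : Ideal R where
  carrier := {f | ∀ P ∈ associatedPrimes R (R ⧸ I), ∃ s, s ∉ P ∧ s * f ∈ I ^ n}
  zero_mem' := by
    intro P hP
    exact ⟨1, fun h => hP.1.ne_top ((Ideal.eq_top_iff_one P).mpr h), by simp⟩
  add_mem' := by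
    intro a b ha hb P hP
    obtain ⟨s, hs, hsa⟩ := ha P hP
    obtain ⟨t, ht, htb⟩ := hb P hP
    refine ⟨s * t, fun h => ((hP.1.mem_or_mem h).elim hs ht), ?_⟩
    have heq : s * t * (a + b) = t * (s * a) + s * (t * b) := by ring
    rw [heq]
    exact Ideal.add_mem _ (Ideal.mul_mem_left _ _ hsa) (Ideal.mul_mem_left _ _ htb)
  smul_mem' := by
    intro r a ha P hP
    obtain ⟨s, hs, hsa⟩ := ha P hP
    refine ⟨s, hs, ?_⟩
    have heq : s * (r • a) = r * (s * a) := by rw [smul_eq_mul]; ring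
    rw [heq]
    exact Ideal.mul_mem_left _ _ hsa

/-- The set of `t×t` minors of the generic `p×q` matrix `X = (x_{ij})` of indeterminates:
determinants of submatrices obtained by choosing `t` rows and `t` columns. -/
def genericMinors (k : Type*) [Field k] (p q t : ℕ) :
    Set (MvPolynomial (Fin p × Fin q) k) :=
  {f | ∃ (ri : Fin t → Fin p) (ci : Fin t → Fin q),
    Function.Injective ri ∧ Function.Injective ci ∧
      f = Matrix.det (Matrix.of fun a b : Fin t => MvPolynomial.X (ri a, ci b))}

section

universe u

/-- Duality for the assignment problem: some permutation supported on the relation `E` is tight for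
integral dual variables `r`, `s`. -/
theorem exists_perm_tight {V : Type*} [Fintype V] [DecidableEq V] (E : V → V → Prop)
    (hE : ∀ a, E a a) (c : V → V → ℤ) (hc : ∀ a, c a a = 0) :
    ∃ (π : Equiv.Perm V) (r s : V → ℤ), (∀ a b, E a b → c a b ≤ r a + s b) ∧
      ∀ a, E a (π a) ∧ r a + s (π a) = c a (π a) := by
  classical
  let S : Set ((V → ℤ) × (V → ℤ)) := {x | ∀ a b, E a b → c a b ≤ x.1 a + x.2 b}
  have hS : S.Nonempty := by
    refine ⟨(fun a => ∑ b, |c a b|, 0), fun a b _ => ?_⟩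
    have := Finset.single_le_sum (f := fun b => |c a b|) (fun i _ => abs_nonneg _)
      (Finset.mem_univ b)
    simpa using (le_abs_self _).trans this
  let obj : ((V → ℤ) × (V → ℤ)) → ℤ := fun x => ∑ a, (x.1 a + x.2 a)
  have hobj : ∀ x ∈ S, 0 ≤ obj x := fun x hx =>
    Finset.sum_nonneg fun a _ => by simpa [hc] using hx a a (hE a)
  obtain ⟨⟨r, s⟩, hrs, hmin⟩ := (measure fun x => (obj x).toNat).wf.has_min S hS
  let N : V → Finset V := fun a => Finset.univ.filter fun b => E a b ∧ r a + s b = c a b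
  have hall : ∀ A : Finset V, A.card ≤ (A.biUnion N).card := by
    intro A
    by_contra! hA
    let y : (V → ℤ) × (V → ℤ) :=
      (fun a => r a - if a ∈ A then 1 else 0, fun b => s b + if b ∈ A.biUnion N then 1 else 0)
    have hy : y ∈ S := by
      intro a b hab
      have h1 : c a b ≤ r a + s b := hrs a b hab
      by_cases ha : a ∈ A
      · by_cases hb : b ∈ A.biUnion N
        · simp only [y, if_pos ha, if_pos hb]; linarith
        · have : r a + s b ≠ c a b := fun h => hb <| Finset.mem_biUnion.2
            ⟨a, ha, by simp [N, hab, h]⟩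
          simp only [y, if_pos ha, if_neg hb]; omega
      · simp only [y, if_neg ha]; split_ifs <;> linarith
    have hyobj : obj y = obj (r, s) - A.card + (A.biUnion N).card := by
      simp only [obj, y, Finset.sum_add_distrib, Finset.sum_sub_distrib, Finset.sum_boole,
        Finset.filter_univ_mem]
      ring
    have := hmin y hy
    have h0 := hobj y hy
    have h1 := hobj _ hrs
    apply this
    change (obj y).toNat < (obj (r, s)).toNat
    omega
  obtain ⟨f, hf, hfN⟩ := (Finset.all_card_le_biUnion_card_iff_exists_injective N).1 hall
  refine ⟨Equiv.ofBijective f (Finite.injective_iff_bijective.1 hf), r, s, hrs, fun a => ?_⟩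
  simpa [N] using hfN a

open scoped Classical in
/-- One half of the Greene-Kleitman theorem: if removing any `k` antichains from the multiset `α`
leaves at least `N` elements, then `α` is partitioned into chains `L i` with
`N ≤ ∑ i, (length (L i) - k)`. -/
theorem exists_chains {σ : Type u} [Fintype σ] (lt : σ → σ → Prop)
    (rk : σ → ℕ) (B : ℕ) (hB : ∀ x, rk x ≤ B) (hlt : ∀ x y, lt x y → rk x < rk y)
    (htr : ∀ x y z, lt x y → lt y z → lt x z)
    (α : σ →₀ ℕ) (k N : ℕ)
    (hN : ∀ F : Fin k → Set σ, (∀ l, ∀ x ∈ F l, ∀ y ∈ F l, ¬ lt x y) →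
      N ≤ ∑ x, if x ∈ ⋃ l, F l then 0 else α x) :
    ∃ (ι : Type u) (_ : Fintype ι) (L : ι → List σ), (∀ i, (L i).Pairwise lt) ∧
      ∑ i, (L i : Multiset σ) = Finsupp.toMultiset α ∧ N ≤ ∑ i, ((L i).length - k) := by
  let P := Σ x : σ, Fin (α x)
  let m := Fintype.card P + 1
  let V := P ⊕ Fin m
  let E : V → V → Prop := fun a b => match a, b with
    | .inl a, .inl b => a = b ∨ lt a.1 b.1
    | _, _ => True
  let c : V → V → ℤ := fun a b => match a, b with
    | .inl a, .inl b => if a = b then 0 else 1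
    | .inl _, .inr _ => 1
    | .inr _, .inl _ => - k
    | .inr _, .inr _ => 0
  obtain ⟨π, r, s, hrs, hπ⟩ := exists_perm_tight E
    (fun a => by rcases a with a | a <;> simp [E]) c (fun a => by rcases a with a | a <;> simp [c])
  -- the value of the optimum
  have hopt : (N : ℤ) ≤ ∑ a, c a (π a) := by
    obtain ⟨h₀, h₁, h01⟩ : ∃ h₀ h₁ : Fin m, π (.inr h₀) = .inr h₁ := by
      by_contra! hcon
      have : ∀ h : Fin m, ∃ a : P, π (.inr h) = .inl a := by
        intro h
        rcases hh : π (.inr h) with a | b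
        · exact ⟨a, rfl⟩
        · exact absurd hh (hcon h b)
      choose g hg using this
      have hinj : Function.Injective g := fun a b hab => by
        have : π (.inr a) = π (.inr b) := by rw [hg, hg, hab]
        exact Sum.inr_injective (π.injective this)
      have := Fintype.card_le_of_injective g hinj
      simp [m] at this
    set d := r (.inr h₀) with hd
    have hd1 : s (.inr h₁) = - d := by
      have := (hπ (.inr h₀)).2
      rw [h01] at this
      simp only [c] at this
      linarith
    have hs : ∀ y : P, - (k : ℤ) ≤ d + s (.inl y) := fun y => hrs (.inr h₀) (.inl y) trivial
    have hr : ∀ y : P, 1 ≤ r (.inl y) - d := fun y => by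
      have := hrs (.inl y) (.inr h₁) trivial
      rw [hd1] at this; simp only [c] at this; linarith
    have hself : ∀ v, 0 ≤ r v + s v := fun v => by
      have := hrs v v (by rcases v with a | a <;> simp [E])
      rcases v with a | a <;> simpa [c] using this
    have hxy : ∀ x y : P, lt x.1 y.1 → 1 ≤ r (.inl x) + s (.inl y) := fun x y h => by
      have := hrs (.inl x) (.inl y) (Or.inr h)
      have hne : x ≠ y := by rintro rfl; exact lt_irrefl _ (hlt _ _ h)
      simpa [c, hne] using this
    let F : Fin k → Set σ := fun l => {x | ∃ i : Fin (α x),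
      r (.inl ⟨x, i⟩) + s (.inl ⟨x, i⟩) = 0 ∧ r (.inl ⟨x, i⟩) - d = l + 1}
    have hF := hN F (by
      rintro l x ⟨i, hi, hi'⟩ y ⟨j, hj, hj'⟩ h
      have := hxy ⟨x, i⟩ ⟨y, j⟩ h
      linarith)
    have h1 : ∑ a, c a (π a) = ∑ a, (r a + s a) := by
      rw [Finset.sum_add_distrib, ← Equiv.sum_comp π s, ← Finset.sum_add_distrib]
      exact Finset.sum_congr rfl fun a _ => ((hπ a).2).symm
    have h2 : ∑ x : σ, (if x ∈ ⋃ l, F l then 0 else (α x : ℤ)) ≤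
        ∑ a : P, (r (.inl a) + s (.inl a)) := by
      rw [Fintype.sum_sigma]
      refine Finset.sum_le_sum fun x _ => ?_
      split_ifs with hx
      · exact Finset.sum_nonneg fun i _ => hself _
      · have : (α x : ℤ) = ∑ i : Fin (α x), 1 := by simp
        rw [this]
        refine Finset.sum_le_sum fun i _ => ?_
        by_contra! hlt1
        have h0 : r (.inl ⟨x, i⟩) + s (.inl ⟨x, i⟩) = 0 := le_antisymm (by linarith) (hself _)
        have ha := hr ⟨x, i⟩
        have hb := hs ⟨x, i⟩
        refine hx (Set.mem_iUnion.2 ⟨⟨(r (.inl ⟨x, i⟩) - d - 1).toNat, by omega⟩, i, h0, ?_⟩)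
        simp only
        omega
    have h3 : (0 : ℤ) ≤ ∑ h : Fin m, (r (.inr h) + s (.inr h)) :=
      Finset.sum_nonneg fun i _ => hself _
    rw [h1, Fintype.sum_sum_type]
    have h4 : (N : ℤ) ≤ ∑ x : σ, (if x ∈ ⋃ l, F l then 0 else (α x : ℤ)) := by
      refine (Int.ofNat_le.2 hF).trans ?_
      push_cast
      exact le_rfl
    linarith
  -- chains following `π`
  have hstep : ∀ a b : P, π (.inl a) = .inl b → a ≠ b → lt a.1 b.1 := by
    intro a b h hne
    have := (hπ (.inl a)).1
    rw [h] at this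
    exact this.resolve_left hne
  let μ : V → ℕ := Sum.elim (fun a => B + 1 - rk a.1) fun _ => 0
  have hμ : ∀ a : P, π (.inl a) ≠ .inl a → μ (π (.inl a)) < μ (.inl a) := by
    intro a ha
    have hBa := hB a.1
    rcases h : π (.inl a) with b | b
    · have hne : a ≠ b := by rintro rfl; exact ha h
      have := hlt _ _ (hstep a b h hne)
      simp only [μ, Sum.elim_inl]; omega
    · simp only [μ, Sum.elim_inl, Sum.elim_inr]; omega
  obtain ⟨ℓ, hℓ⟩ : ∃ ℓ : V → List σ, ∀ v, ℓ v = match v with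
      | .inl a => if π (.inl a) = .inl a then [] else a.1 :: ℓ (π (.inl a))
      | .inr _ => [] := by
    let G : (v : V) → ((w : V) → μ w < μ v → List σ) → List σ := fun v rec => match v, rec with
      | .inl a, rec => if h : π (.inl a) = .inl a then [] else a.1 :: rec (π (.inl a)) (hμ a h)
      | .inr _, _ => []
    refine ⟨(measure μ).wf.fix G, fun v => ?_⟩
    rw [WellFounded.fix_eq]
    rcases v with a | a
    · simp only [G]
      split_ifs <;> rfl
    · rfl
  have hℓr : ∀ h, ℓ (.inr h) = [] := fun h => hℓ _
  have hℓf : ∀ a, π (.inl a) = .inl a → ℓ (.inl a) = [] := fun a h => by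
    rw [hℓ]; simp [h]
  have hℓn : ∀ a, π (.inl a) ≠ .inl a → ℓ (.inl a) = a.1 :: ℓ (π (.inl a)) := fun a h => by
    rw [hℓ]; simp [h]
  have hchain : ∀ n, ∀ v, μ v ≤ n → (ℓ v).Pairwise lt ∧
      ∀ a, v = .inl a → ∀ x ∈ ℓ v, a.1 = x ∨ lt a.1 x := by
    intro n
    induction n with
    | zero =>
      rintro (a | a) hv
      · have := hB a.1
        simp only [μ, Sum.elim_inl] at hv; omega
      · simp [hℓr]
    | succ n ih =>
      rintro (a | a) hv
      · by_cases ha : π (.inl a) = .inl a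
        · simp [hℓf a ha]
        · have ih' := ih (π (.inl a)) (by have := hμ a ha; omega)
          have key : ∀ x ∈ ℓ (π (.inl a)), lt a.1 x := by
            intro x hx
            rcases h : π (.inl a) with b | b
            · have hne : a ≠ b := by rintro rfl; exact ha h
              have hab := hstep a b h hne
              rcases ih'.2 b h x hx with rfl | hbx
              · exact hab
              · exact htr _ _ _ hab hbx
            · rw [h, hℓr] at hx; simp at hx
          rw [hℓn a ha]
          refine ⟨List.pairwise_cons.2 ⟨key, ih'.1⟩, ?_⟩
          rintro b ⟨⟩ x hx
          rcases List.mem_cons.1 hx with rfl | hx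
          · exact Or.inl rfl
          · exact Or.inr (key x hx)
      · simp [hℓr]
  -- telescoping
  have htel : ∑ h : Fin m, (ℓ (π (.inr h)) : Multiset σ) =
      ∑ a : P, if π (.inl a) = .inl a then 0 else {a.1} := by
    have e1 := Equiv.sum_comp π fun v => (ℓ v : Multiset σ)
    rw [Fintype.sum_sum_type, Fintype.sum_sum_type] at e1
    have e2 : ∀ a : P, (ℓ (.inl a) : Multiset σ) =
        (if π (.inl a) = .inl a then 0 else {a.1}) + (ℓ (π (.inl a)) : Multiset σ) := by
      intro a
      by_cases ha : π (.inl a) = .inl a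
      · rw [ha, hℓf a ha]; simp
      · rw [hℓn a ha]; simp [ha]
    simp only [e2, hℓr, Finset.sum_add_distrib, Multiset.coe_nil,
      Finset.sum_const_zero, add_zero] at e1
    rw [add_comm] at e1
    exact add_right_cancel e1
  have hlen := congrArg Multiset.card htel
  simp only [Multiset.card_sum, Multiset.coe_card, apply_ite Multiset.card, Multiset.card_zero,
    Multiset.card_singleton] at hlen
  refine ⟨V, inferInstance, Sum.elim (fun a => if π (.inl a) = .inl a then [a.1] else [])
    fun h => ℓ (π (.inr h)), ?_, ?_, ?_⟩
  · rintro (a | a)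
    · simp only [Sum.elim_inl]; split_ifs <;> simp
    · exact (hchain _ _ le_rfl).1
  · rw [Fintype.sum_sum_type]
    simp only [Sum.elim_inl, Sum.elim_inr]
    rw [htel, ← Finset.sum_add_distrib]
    have : ∀ a : P, (((if π (.inl a) = .inl a then [a.1] else []) : List σ) : Multiset σ) +
        (if π (.inl a) = .inl a then 0 else {a.1}) = {a.1} := by
      intro a; split_ifs <;> simp
    simp only [this]
    rw [Fintype.sum_sigma]
    simp [Finsupp.toMultiset_apply, Finsupp.sum_fintype]
  · rw [Fintype.sum_sum_type]
    simp only [Sum.elim_inl, Sum.elim_inr]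
    have h5 : ∀ a : P, c (.inl a) (π (.inl a)) =
        ((if π (.inl a) = .inl a then 0 else 1 : ℕ) : ℤ) := by
      intro a
      rcases h : π (.inl a) with b | b
      · by_cases hab : a = b
        · simp [c, hab]
        · have hne : (Sum.inl b : V) ≠ .inl a := fun e => hab (Sum.inl_injective e).symm
          simp [c, hab, hne]
      · simp [c]
    have h6 : ∀ h : Fin m, c (.inr h) (π (.inr h)) + ((ℓ (π (.inr h))).length : ℤ) ≤
        ((ℓ (π (.inr h))).length - k : ℕ) := by
      intro h
      rcases h' : π (.inr h) with b | b
      · simp only [c]; omega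
      · simp [c, hℓr]
    have h7 := Finset.sum_le_sum fun h (_ : h ∈ Finset.univ) => h6 h
    rw [Fintype.sum_sum_type] at hopt
    simp only [h5, ← Nat.cast_sum, ← hlen, Finset.sum_add_distrib] at hopt h7
    have h8 : (N : ℤ) ≤ ((∑ h : Fin m, ((ℓ (π (.inr h))).length - k) : ℕ) : ℤ) := by
      linarith
    omega

open MvPolynomial

theorem sum_mul_perm_lt {s : ℕ} {f g : Fin s → ℕ} (hf : StrictMono f) (hg : StrictMono g)
    {π : Equiv.Perm (Fin s)} (hπ : π ≠ 1) : ∑ a, f (π a) * g a < ∑ a, f a * g a := by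
  have hfg : Monovary f g := hf.monotone.monovary hg.monotone
  rw [hfg.sum_comp_perm_mul_lt_sum_mul_iff]
  intro h
  refine hπ ((Equiv.Perm.monotone_iff π).1 fun a b hab => ?_)
  rcases hab.eq_or_lt with rfl | hab
  · exact le_rfl
  · exact hf.le_iff_le.1 (h (hg hab))

/-- The weight `f i * g j + L` admits dual potentials that are tight on a given antichain. -/
theorem exists_potential {p q : ℕ} {f g : ℕ → ℕ} (hf : Monotone f) (hg : Monotone g)
    {L : ℕ} (hL : f p * g q ≤ L) (A : Set (Fin p × Fin q))
    (hA : ∀ x ∈ A, ∀ y ∈ A, ¬ (x.1 < y.1 ∧ x.2 < y.2)) :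
    ∃ (u : Fin p → ℕ) (v : Fin q → ℕ), (∀ i j, u i + v j ≤ f i * g j + L) ∧
      ∀ i j, (i, j) ∈ A → u i + v j = f i * g j + L := by
  classical
  let c : ℕ → ℕ := fun a =>
    (Finset.univ.filter fun x : Fin p × Fin q => x ∈ A ∧ a ≤ x.1).sup fun x => (x.2 : ℕ)
  have hcq : ∀ a, c a ≤ q := fun a => Finset.sup_le fun x _ => x.2.2.le
  have hc1 : ∀ x ∈ A, ∀ a : ℕ, a ≤ x.1 → (x.2 : ℕ) ≤ c a := fun x hx a ha =>
    Finset.le_sup (f := fun x : Fin p × Fin q => (x.2 : ℕ)) (by simp [hx, ha])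
  have hc2 : ∀ x ∈ A, ∀ a : ℕ, (x.1 : ℕ) < a → c a ≤ x.2 := fun x hx a ha => by
    refine Finset.sup_le fun y hy => ?_
    simp only [Finset.mem_filter, Finset.mem_univ, true_and] at hy
    by_contra! hlt
    exact hA x hx y hy.1 ⟨Fin.lt_def.2 (by omega), Fin.lt_def.2 hlt⟩
  let u : ℕ → ℕ := fun i => ∑ i' ∈ Finset.range i, (f (i' + 1) - f i') * g (c (i' + 1))
  have hus : ∀ i, u (i + 1) = u i + (f (i + 1) - f i) * g (c (i + 1)) := fun i =>
    Finset.sum_range_succ _ _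
  have hfs : ∀ i, f (i + 1) = f i + (f (i + 1) - f i) := fun i => by
    have := hf (Nat.le_succ i); simp only [Nat.succ_eq_add_one] at this; omega
  have huf : ∀ i, u i ≤ f i * g q := by
    intro i
    induction i with
    | zero => simp [u]
    | succ i ih =>
      rw [hus, hfs i, add_mul, ← hfs i]
      gcongr
      exact hg (hcq _)
  have huL : ∀ i : Fin p, u i ≤ L := fun i =>
    ((huf i).trans (Nat.mul_le_mul_right _ (hf i.2.le))).trans hL
  have hup : ∀ x ∈ A, ∀ i : ℕ, x.1 ≤ i → u i + f x.1 * g x.2 ≤ u x.1 + f i * g x.2 := by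
    intro x hx i hi
    induction i, hi using Nat.le_induction with
    | base => exact le_rfl
    | succ i hi ih =>
      have h1 := Nat.mul_le_mul_left (f (i + 1) - f i) (hg (hc2 x hx (i + 1) (by omega)))
      rw [hus, hfs i, add_mul, ← hfs i]
      linarith
  have hdown : ∀ x ∈ A, ∀ i : ℕ, i ≤ x.1 → u i + f x.1 * g x.2 ≤ u x.1 + f i * g x.2 := by
    intro x hx i hi
    have : ∀ m, i ≤ m → m ≤ x.1 → u i + f m * g x.2 ≤ u m + f i * g x.2 := by
      intro m hm
      induction m, hm using Nat.le_induction with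
      | base => intro _; exact le_rfl
      | succ m hm ih =>
        intro hmx
        have h1 := Nat.mul_le_mul_left (f (m + 1) - f m) (hg (hc1 x hx (m + 1) hmx))
        have := ih (by omega)
        rw [hus, hfs m, add_mul, ← hfs m]
        linarith
    exact this _ hi le_rfl
  have hle : ∀ (i : Fin p) (j : Fin q), u i + ⨅ i' : Fin p, (f i' * g j + L - u i') ≤
      f i * g j + L := fun i j => by
    have h1 : ⨅ i' : Fin p, (f i' * g j + L - u i') ≤ _ := ciInf_le (OrderBot.bddBelow _) i
    have := huL i
    omega
  refine ⟨fun i => u i, fun j => ⨅ i' : Fin p, (f i' * g j + L - u i'), hle,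
    fun i j hij => le_antisymm (hle i j) ?_⟩
  have : Nonempty (Fin p) := ⟨i⟩
  have h2 : f i * g j + L - u i ≤ ⨅ i' : Fin p, (f i' * g j + L - u i') := by
    refine le_ciInf fun i' => ?_
    have h3 := huL i'
    have h4 := huL i
    have h5 : u i' + f i * g j ≤ u i + f i' * g j := by
      rcases le_total (i : ℕ) i' with h | h
      · exact hup _ hij _ h
      · exact hdown _ hij _ h
    omega
  have := huL i
  change f i * g j + L ≤ u i + ⨅ i' : Fin p, (f i' * g j + L - u i')
  omega

theorem weight_injOn_degree_le {p q d b L : ℕ} (hb : d < b) (hL : b ^ (p * q) ∣ L)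
    {α β : Fin p × Fin q →₀ ℕ} (hα : α.degree ≤ d) (hβ : β.degree ≤ d)
    (h : Finsupp.weight (fun x : Fin p × Fin q => b ^ (q * x.1) * b ^ (x.2 : ℕ) + L) α =
      Finsupp.weight (fun x : Fin p × Fin q => b ^ (q * x.1) * b ^ (x.2 : ℕ) + L) β) : α = β := by
  have hlt : ∀ γ : Fin p × Fin q →₀ ℕ, γ.degree ≤ d → ∀ x, γ x < b := fun γ hγ x =>
    ((Finsupp.le_degree x γ).trans hγ).trans_lt hb
  let D : (γ : Fin p × Fin q →₀ ℕ) → γ.degree ≤ d → Fin (p * q) → Fin b := fun γ hγ i =>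
    ⟨γ (finProdFinEquiv.symm i), hlt γ hγ _⟩
  have hw : ∀ γ (hγ : γ.degree ≤ d),
      Finsupp.weight (fun x : Fin p × Fin q => b ^ (q * x.1) * b ^ (x.2 : ℕ) + L) γ =
      finFunctionFinEquiv (D γ hγ) + L * γ.degree := by
    intro γ hγ
    rw [finFunctionFinEquiv_apply_val, Finsupp.weight_apply,
      Finsupp.sum_fintype _ _ (by simp), Finsupp.degree_eq_sum, Finset.mul_sum,
      ← finProdFinEquiv.sum_comp, ← Finset.sum_add_distrib]
    refine Finset.sum_congr rfl fun x _ => ?_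
    simp [D, pow_add]
    ring
  obtain ⟨m, rfl⟩ := hL
  rw [hw α hα, hw β hβ] at h
  have h' := congrArg (· % b ^ (p * q)) h
  simp only [mul_assoc, Nat.add_mul_mod_self_left, Nat.mod_eq_of_lt (Fin.is_lt _)] at h'
  have hD := finFunctionFinEquiv.injective (Fin.ext h')
  ext x
  have := congrArg Fin.val (congrFun hD (finProdFinEquiv x))
  simpa [D] using this

/-- A weight on the variables which is diagonal, admits potentials tight on any given antichain, and
separates the monomials of degree at most `d`. -/
theorem exists_weight (p q d : ℕ) : ∃ w : Fin p × Fin q → ℕ,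
    (∀ {s : ℕ} {r : Fin s → Fin p} {c : Fin s → Fin q}, StrictMono r → StrictMono c →
      ∀ {π : Equiv.Perm (Fin s)}, π ≠ 1 → ∑ a, w (r (π a), c a) < ∑ a, w (r a, c a)) ∧
    (∀ A : Set (Fin p × Fin q), (∀ x ∈ A, ∀ y ∈ A, ¬ (x.1 < y.1 ∧ x.2 < y.2)) →
      ∃ (u : Fin p → ℕ) (v : Fin q → ℕ), (∀ x, u x.1 + v x.2 ≤ w x) ∧
        ∀ x ∈ A, u x.1 + v x.2 = w x) ∧
    ∀ α β : Fin p × Fin q →₀ ℕ, α.degree ≤ d → β.degree ≤ d →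
      Finsupp.weight w α = Finsupp.weight w β → α = β := by
  let b := d + 2
  rcases Nat.eq_zero_or_pos q with rfl | hq
  · refine ⟨fun _ => 0, ?_, ?_, ?_⟩
    · intro s r c _ _ π hπ
      rcases s with _ | s
      · exact absurd (Subsingleton.elim _ _) hπ
      · exact (c 0).elim0
    · exact fun A _ => ⟨0, 0, by simp, by simp⟩
    · intro α β _ _ _
      ext x
      exact x.2.elim0
  refine ⟨fun x => b ^ (q * x.1) * b ^ (x.2 : ℕ) + b ^ (p * q) * b ^ q, ?_, ?_, ?_⟩
  · intro s r c hr hc π hπ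
    simp only [Finset.sum_add_distrib]
    have := sum_mul_perm_lt (f := fun a => b ^ (q * r a)) (g := fun a => b ^ (c a : ℕ))
      (fun x y h => Nat.pow_lt_pow_right (by omega) (Nat.mul_lt_mul_of_pos_left (hr h) hq))
      (fun x y h => Nat.pow_lt_pow_right (by omega) (hc h)) hπ
    simpa using this
  · intro A hA
    obtain ⟨u, v, h1, h2⟩ := exists_potential (f := fun i => b ^ (q * i)) (g := fun j => b ^ j)
      (L := b ^ (p * q) * b ^ q)
      (fun x y h => Nat.pow_le_pow_right (by omega) (Nat.mul_le_mul_left _ h))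
      (fun x y h => Nat.pow_le_pow_right (by omega) h) (by rw [mul_comm p q]) A hA
    exact ⟨u, v, fun x => h1 _ _, fun x hx => h2 _ _ hx⟩
  · intro α β hα hβ h
    exact weight_injOn_degree_le (by omega) (Dvd.intro _ rfl) hα hβ h

/-- The minor of the generic `p × q` matrix with rows `r` and columns `c`. -/
noncomputable def genericMinor (K : Type*) [Field K] {p q s : ℕ} (r : Fin s → Fin p)
    (c : Fin s → Fin q) : MvPolynomial (Fin p × Fin q) K :=
  Matrix.det (Matrix.of fun a b => X (r a, c b))

/-- `IsWeightedMinorProduct K p q k n f` says that `f` is a product of minors of the generic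
matrix, where minors of size `s` contribute at most `s - k` to the weight `n`. -/
inductive IsWeightedMinorProduct (K : Type*) [Field K] (p q k : ℕ) :
    ℕ → MvPolynomial (Fin p × Fin q) K → Prop
  | one : IsWeightedMinorProduct K p q k 0 1
  | mul {n s g : ℕ} {f : MvPolynomial (Fin p × Fin q) K} (r : Fin s → Fin p) (c : Fin s → Fin q)
      (hr : StrictMono r) (hc : StrictMono c) (hg : g ≤ s - k)
      (hf : IsWeightedMinorProduct K p q k n f) :
      IsWeightedMinorProduct K p q k (g + n) (genericMinor K r c * f)

/-- The ideal generated by the products of minors of weight at least `n`. -/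
noncomputable def minorProductIdeal (K : Type*) [Field K] (p q k n : ℕ) :
    Ideal (MvPolynomial (Fin p × Fin q) K) :=
  Ideal.span {f | ∃ m, n ≤ m ∧ IsWeightedMinorProduct K p q k m f}

section
variable {K : Type*} [Field K] {p q k : ℕ}

theorem IsWeightedMinorProduct.mul_mul {m n : ℕ} {f g : MvPolynomial (Fin p × Fin q) K}
    (hf : IsWeightedMinorProduct K p q k m f) (hg : IsWeightedMinorProduct K p q k n g) :
    IsWeightedMinorProduct K p q k (m + n) (f * g) := by
  induction hf with
  | one => simpa using hg
  | mul r c hr hc h _ ih => rw [add_assoc, mul_assoc]; exact .mul r c hr hc h ih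

theorem minorProductIdeal_mul_le (m n : ℕ) :
    minorProductIdeal K p q k m * minorProductIdeal K p q k n ≤
      minorProductIdeal K p q k (m + n) := by
  rw [minorProductIdeal, minorProductIdeal, Ideal.span_mul_span, Ideal.span_le]
  rintro _ ⟨f, ⟨a, ha, hf⟩, g, ⟨b, hb, hg⟩, rfl⟩
  exact Ideal.subset_span ⟨a + b, by omega, hf.mul_mul hg⟩

theorem minorProductIdeal_zero : minorProductIdeal K p q k 0 = ⊤ :=
  (Ideal.eq_top_iff_one _).2 (Ideal.subset_span ⟨0, le_rfl, .one⟩)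

theorem genericMinor_mem_minorProductIdeal {s g : ℕ} {r : Fin s → Fin p} {c : Fin s → Fin q}
    (hr : StrictMono r) (hc : StrictMono c) (hg : g ≤ s - k) :
    genericMinor K r c ∈ minorProductIdeal K p q k g :=
  Ideal.subset_span ⟨g, le_rfl, by simpa using IsWeightedMinorProduct.mul r c hr hc hg .one⟩

/-- Laplace expansion: a minor of size `s + f` lies in the `f`-th power of the maximal ideal times
any ideal containing the minors of size `s`. -/
theorem genericMinor_mem_pow_mul {s : ℕ} (J : Ideal (MvPolynomial (Fin p × Fin q) K))
    (hJ : ∀ (r : Fin s → Fin p) (c : Fin s → Fin q), StrictMono r → StrictMono c →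
      genericMinor K r c ∈ J) (f : ℕ) {r : Fin (s + f) → Fin p} {c : Fin (s + f) → Fin q}
    (hr : StrictMono r) (hc : StrictMono c) :
    genericMinor K r c ∈
      Ideal.span (Set.range (X : Fin p × Fin q → MvPolynomial (Fin p × Fin q) K)) ^ f * J := by
  induction f with
  | zero => simpa using hJ r c hr hc
  | succ f ih =>
    change Matrix.det (n := Fin (s + f + 1)) _ ∈ _
    rw [Matrix.det_succ_row_zero, pow_succ', mul_assoc]
    refine Ideal.sum_mem _ fun j _ => ?_
    rw [mul_assoc]
    refine Ideal.mul_mem_left _ _ (Ideal.mul_mem_mul (Ideal.subset_span ⟨_, rfl⟩) ?_)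
    exact ih (r := r ∘ Fin.succ) (c := c ∘ j.succAbove)
      (hr.comp Fin.strictMono_succ) (hc.comp (Fin.strictMono_succAbove j))

theorem card_le_of_strictMono {s : ℕ} {r : Fin s → Fin p} (hr : StrictMono r) : s ≤ p := by
  simpa using Fintype.card_le_of_injective r hr.injective

theorem genericMinor_mem_pow_mul_minorProductIdeal {s f g : ℕ} {r : Fin s → Fin p}
    {c : Fin s → Fin q} (hr : StrictMono r) (hc : StrictMono c) (h : f + g ≤ s - k) :
    genericMinor K r c ∈
      Ideal.span (Set.range (X : Fin p × Fin q → MvPolynomial (Fin p × Fin q) K)) ^ f *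
        minorProductIdeal K p q k g := by
  obtain ⟨s', rfl⟩ : ∃ s', s = s' + f := ⟨s - f, by omega⟩
  exact genericMinor_mem_pow_mul _
    (fun r c hr hc => genericMinor_mem_minorProductIdeal hr hc (by omega)) f hr hc

/-- Grouping the factors of a product of minors. -/
theorem IsWeightedMinorProduct.mem_pow_mul {n : ℕ} {F : MvPolynomial (Fin p × Fin q) K}
    (hF : IsWeightedMinorProduct K p q k n F) {m e : ℕ} (hm : 1 ≤ m) (he : p ≤ k + e + 1) :
    ∀ a r D : ℕ, a ≤ m → r * e ≤ D → a + r * m + D ≤ n →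
      F ∈ Ideal.span (Set.range (X : Fin p × Fin q → MvPolynomial (Fin p × Fin q) K)) ^ D *
        minorProductIdeal K p q k a * minorProductIdeal K p q k m ^ r := by
  set M := Ideal.span (Set.range (X : Fin p × Fin q → MvPolynomial (Fin p × Fin q) K)) with hM
  set J := minorProductIdeal K p q k with hJ
  have hJ0 : J 0 = ⊤ := minorProductIdeal_zero
  induction hF with
  | one =>
    intro a r D ha hD h
    obtain rfl : a = 0 := by omega
    obtain rfl : D = 0 := by omega
    obtain rfl : r = 0 := by
      by_contra hr
      have := Nat.mul_le_mul (Nat.one_le_iff_ne_zero.2 hr) hm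
      omega
    simp [hJ0]
  | @mul n s g F ri ci hr hc hg hF ih =>
    have hs := card_le_of_strictMono hr
    -- the case where the current group is nonempty
    have key : ∀ a r D : ℕ, (1 ≤ a ∨ r = 0) → a ≤ m → r * e ≤ D → a + r * m + D ≤ g + n →
        genericMinor K ri ci * F ∈ M ^ D * J a * J m ^ r := by
      intro a r D har ha hD h
      rcases le_or_gt g a with hga | hga
      · have h1 : genericMinor K ri ci ∈ J g := genericMinor_mem_minorProductIdeal hr hc hg
        have h2 := ih (a - g) r D (by omega) hD (by omega)
        have h3 : J g * J (a - g) ≤ J a := by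
          have := minorProductIdeal_mul_le (K := K) (p := p) (q := q) (k := k) g (a - g)
          rwa [Nat.add_sub_cancel' hga] at this
        have h4 : J g * (M ^ D * J (a - g) * J m ^ r) ≤ M ^ D * J a * J m ^ r :=
          calc _ = M ^ D * (J g * J (a - g)) * J m ^ r := by ring
            _ ≤ _ := Ideal.mul_mono_left (Ideal.mul_mono_right h3)
        exact h4 (Ideal.mul_mem_mul h1 h2)
      · have h1 : genericMinor K ri ci ∈ M ^ (g - a) * J a :=
          genericMinor_mem_pow_mul_minorProductIdeal hr hc (by omega)
        have h5 : M ^ (g - a) * M ^ (D - (g - a)) ≤ M ^ D := by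
          rw [← pow_add]; exact Ideal.pow_le_pow_right (by omega)
        rcases r with _ | r
        · have h2 := ih 0 0 (D - (g - a)) (by omega) (by omega) (by omega)
          have h4 : M ^ (g - a) * J a * (M ^ (D - (g - a)) * J 0 * J m ^ 0) ≤
              M ^ D * J a * J m ^ 0 := by
            simp only [hJ0, pow_zero, mul_one, Ideal.mul_top]
            calc _ = (M ^ (g - a) * M ^ (D - (g - a))) * J a := by ring
              _ ≤ _ := Ideal.mul_mono_left h5
          exact h4 (Ideal.mul_mem_mul h1 h2)
        · rw [Nat.add_mul] at hD h
          have h2 := ih m r (D - (g - a)) le_rfl (by omega) (by omega)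
          have h4 : M ^ (g - a) * J a * (M ^ (D - (g - a)) * J m * J m ^ r) ≤
              M ^ D * J a * J m ^ (r + 1) := by
            calc _ = (M ^ (g - a) * M ^ (D - (g - a))) * (J a * J m ^ (r + 1)) := by ring
              _ ≤ M ^ D * (J a * J m ^ (r + 1)) := Ideal.mul_mono_left h5
              _ = _ := by ring
          exact h4 (Ideal.mul_mem_mul h1 h2)
    intro a r D ha hD h
    rcases Nat.eq_zero_or_pos a with rfl | ha0
    · rcases r with _ | r
      · exact key 0 0 D (.inr rfl) ha hD h
      · rw [Nat.add_mul] at hD h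
        have := key m r D (.inl hm) le_rfl (by omega) (by omega)
        rwa [hJ0, Ideal.mul_top, pow_succ', ← mul_assoc]
    · exact key a r D (.inl ha0) ha hD h

theorem minorProductIdeal_le_pow_mul {m e r D : ℕ} (hm : 1 ≤ m) (he : p ≤ k + e + 1)
    (hD : r * e ≤ D) :
    minorProductIdeal K p q k ((r + 1) * m + D) ≤
      Ideal.span (Set.range (X : Fin p × Fin q → MvPolynomial (Fin p × Fin q) K)) ^ D *
        minorProductIdeal K p q k m ^ (r + 1) := by
  refine Ideal.span_le.2 ?_
  rintro f ⟨n, hn, hf⟩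
  have := hf.mem_pow_mul hm he m r D le_rfl hD (by rw [Nat.add_mul] at hn; omega)
  rwa [mul_assoc, ← pow_succ'] at this

/-! ### Leading monomials -/

/-- `f` is the sum of the monomial `x ^ α` and of monomials of smaller weight and no
larger degree. -/
def HasLeadingMonomial (w : Fin p × Fin q → ℕ) (α : Fin p × Fin q →₀ ℕ)
    (f : MvPolynomial (Fin p × Fin q) K) : Prop :=
  f - monomial α 1 ∈
    restrictSupport K {β | β.degree ≤ α.degree ∧ Finsupp.weight w β < Finsupp.weight w α}

theorem HasLeadingMonomial.one (w : Fin p × Fin q → ℕ) :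
    HasLeadingMonomial w 0 (1 : MvPolynomial (Fin p × Fin q) K) := by
  simp [HasLeadingMonomial]

theorem mul_mem_restrictSupport_of_add {σ : Type*} {A B C : Set (σ →₀ ℕ)} {f g : MvPolynomial σ K}
    (hf : f ∈ restrictSupport K A) (hg : g ∈ restrictSupport K B)
    (h : ∀ a ∈ A, ∀ b ∈ B, a + b ∈ C) : f * g ∈ restrictSupport K C := by
  classical
  rw [mem_restrictSupport_iff] at *
  intro x hx
  obtain ⟨a, ha, b, hb, rfl⟩ := Finset.mem_add.1 (support_mul f g hx)
  exact h a (hf ha) b (hg hb)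

theorem HasLeadingMonomial.mul {w : Fin p × Fin q → ℕ} {α β : Fin p × Fin q →₀ ℕ}
    {f g : MvPolynomial (Fin p × Fin q) K} (hf : HasLeadingMonomial w α f)
    (hg : HasLeadingMonomial w β g) : HasLeadingMonomial w (α + β) (f * g) := by
  have hmono : ∀ γ : Fin p × Fin q →₀ ℕ, monomial γ (1 : K) ∈ restrictSupport K {γ} := by
    intro γ
    rw [mem_restrictSupport_iff]
    exact_mod_cast support_monomial_subset
  have hfg : f * g - monomial (α + β) 1 = (f - monomial α 1) * (g - monomial β 1) +
      monomial α 1 * (g - monomial β 1) + (f - monomial α 1) * monomial β 1 := by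
    rw [show monomial (α + β) (1 : K) = monomial α 1 * monomial β 1 by simp [monomial_mul]]
    ring
  rw [HasLeadingMonomial, hfg]
  refine Submodule.add_mem _ (Submodule.add_mem _ ?_ ?_) ?_
  · refine mul_mem_restrictSupport_of_add hf hg fun a ha b hb => ?_
    simp only [Set.mem_ofPred_eq, map_add] at *
    omega
  · refine mul_mem_restrictSupport_of_add (hmono α) hg fun a ha b hb => ?_
    simp only [Set.mem_ofPred_eq, Set.mem_singleton_iff, map_add] at *
    subst ha
    omega
  · refine mul_mem_restrictSupport_of_add hf (hmono β) fun a ha b hb => ?_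
    simp only [Set.mem_ofPred_eq, Set.mem_singleton_iff, map_add] at *
    subst hb
    omega

theorem hasLeadingMonomial_genericMinor {w : Fin p × Fin q → ℕ}
    {s : ℕ} {r : Fin s → Fin p} {c : Fin s → Fin q}
    (hw : ∀ π : Equiv.Perm (Fin s), π ≠ 1 → ∑ a, w (r (π a), c a) < ∑ a, w (r a, c a)) :
    HasLeadingMonomial w (∑ a, Finsupp.single (r a, c a) 1) (genericMinor K r c) := by
  have hprod : ∀ π : Equiv.Perm (Fin s), ∏ a, (X (r (π a), c a) : MvPolynomial (Fin p × Fin q) K)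
      = monomial (∑ a, Finsupp.single (r (π a), c a) 1) 1 := by
    intro π
    rw [monomial_sum_one]; rfl
  rw [HasLeadingMonomial, genericMinor, Matrix.det_apply]
  simp only [Matrix.of_apply, hprod]
  rw [← Finset.add_sum_erase _ _ (Finset.mem_univ (1 : Equiv.Perm (Fin s)))]
  simp only [Equiv.Perm.sign_one, one_smul, Equiv.Perm.coe_one, id_eq, add_sub_cancel_left]
  refine Submodule.sum_mem _ fun π hπ => ?_
  rw [Units.smul_def]
  refine zsmul_mem ?_ _
  rw [mem_restrictSupport_iff]
  refine (Finset.coe_subset.2 support_monomial_subset).trans ?_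
  simp only [Finset.coe_singleton, Set.singleton_subset_iff, Set.mem_ofPred_eq, map_sum,
    Finsupp.degree_single, Finsupp.weight_single, smul_eq_mul, one_mul]
  exact ⟨le_rfl, hw π (Finset.ne_of_mem_erase hπ)⟩
theorem det_mul_eq_zero_of_card {R : Type*} [CommRing R] {k : ℕ}
    (U : Matrix (Fin (k + 1)) (Fin k) R) (V : Matrix (Fin k) (Fin (k + 1)) R) :
    (U * V).det = 0 := by
  let U' : Matrix (Fin (k + 1)) (Fin (k + 1)) R := Matrix.of fun a => Fin.snoc (U a) 0
  let V' : Matrix (Fin (k + 1)) (Fin (k + 1)) R :=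
    Matrix.of fun a b => Fin.snoc (α := fun _ => R) (fun l => V l b) 0 a
  have h : U * V = U' * V' := by
    ext a b
    simp [Matrix.mul_apply, Fin.sum_univ_castSucc, U', V']
  rw [h, Matrix.det_mul, Matrix.det_eq_zero_of_column_eq_zero (Fin.last k) (by simp [U']),
    zero_mul]

/-! ### The order of vanishing along matrices of rank at most `k` -/

/-- Substitution of `U * V + T • Z` for the generic matrix, where the entries of the `p × k`
matrix `U`, of the `k × q` matrix `V` and of the `p × q` matrix `Z`, and `T`, are indeterminates. -/
noncomputable def rankSubst (K : Type*) [Field K] (p q k : ℕ) :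
    MvPolynomial (Fin p × Fin q) K →ₐ[K]
      Polynomial (MvPolynomial ((Fin p × Fin k) ⊕ (Fin k × Fin q) ⊕ (Fin p × Fin q)) K) :=
  aeval fun x => Polynomial.C (∑ l, X (.inl (x.1, l)) * X (.inr (.inl (l, x.2)))) +
    Polynomial.X * Polynomial.C (X (.inr (.inr x)))

/-- The polynomials vanishing to order at least `n` along the matrices of rank at most `k`. -/
noncomputable def rankOrderIdeal (K : Type*) [Field K] (p q k n : ℕ) :
    Ideal (MvPolynomial (Fin p × Fin q) K) :=
  (Ideal.span {Polynomial.X ^ n}).comap (rankSubst K p q k)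

theorem mem_rankOrderIdeal {n : ℕ} {f : MvPolynomial (Fin p × Fin q) K} :
    f ∈ rankOrderIdeal K p q k n ↔ Polynomial.X ^ n ∣ rankSubst K p q k f := by
  rw [rankOrderIdeal, Ideal.mem_comap, Ideal.mem_span_singleton]

theorem pow_dvd_aeval_of_mem_rankOrderIdeal {n : ℕ} {f : MvPolynomial (Fin p × Fin q) K}
    (hf : f ∈ rankOrderIdeal K p q k n) {S : Type*} [CommRing S] [Algebra K S]
    (U : Fin p → Fin k → S) (V : Fin k → Fin q → S) (Z : Fin p × Fin q → S) (y : S) :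
    y ^ n ∣ aeval (fun x => ∑ l, U x.1 l * V l x.2 + y * Z x) f := by
  let θ₀ : MvPolynomial ((Fin p × Fin k) ⊕ (Fin k × Fin q) ⊕ (Fin p × Fin q)) K →ₐ[K] S :=
    aeval (Sum.elim (fun x => U x.1 x.2) (Sum.elim (fun x => V x.1 x.2) Z))
  let θ := Polynomial.eval₂RingHom θ₀.toRingHom y
  have h : ∀ g, θ (rankSubst K p q k g) = aeval (fun x => ∑ l, U x.1 l * V l x.2 + y * Z x) g := by
    intro g
    induction g using MvPolynomial.induction_on with
    | C a =>
      simp only [rankSubst, algHom_C, θ, Polynomial.coe_eval₂RingHom, Polynomial.algebraMap_apply,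
        Polynomial.eval₂_C]
      exact θ₀.commutes a
    | add f g hf hg => simp only [map_add, hf, hg]
    | mul_X f x hf =>
      rw [map_mul, map_mul, map_mul, hf]
      congr 1
      simp [rankSubst, θ, θ₀, Polynomial.eval₂_finsetSum, mul_comm y]
  have := map_dvd θ (mem_rankOrderIdeal.1 hf)
  rwa [h, map_pow, show θ Polynomial.X = y by simp [θ]] at this

theorem rankOrderIdeal_one_isPrime : (rankOrderIdeal K p q k 1).IsPrime := by
  rw [rankOrderIdeal, pow_one]
  have : (Ideal.span {(Polynomial.X : Polynomial
      (MvPolynomial ((Fin p × Fin k) ⊕ (Fin k × Fin q) ⊕ (Fin p × Fin q)) K))}).IsPrime :=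
    (Ideal.span_singleton_prime Polynomial.X_ne_zero).2 Polynomial.prime_X
  exact Ideal.comap_isPrime _ _

theorem mem_rankOrderIdeal_of_mul_mem {n : ℕ} {s f : MvPolynomial (Fin p × Fin q) K}
    (hs : s ∉ rankOrderIdeal K p q k 1) (h : s * f ∈ rankOrderIdeal K p q k n) :
    f ∈ rankOrderIdeal K p q k n := by
  rw [mem_rankOrderIdeal] at *
  rw [map_mul] at h
  rw [pow_one] at hs
  exact Polynomial.prime_X.pow_dvd_of_dvd_mul_left n hs h

theorem rankOrderIdeal_one_pow_le (n : ℕ) :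
    rankOrderIdeal K p q k 1 ^ n ≤ rankOrderIdeal K p q k n := by
  refine (Ideal.le_comap_pow _ n).trans ?_
  rw [pow_one, Ideal.span_singleton_pow]
  exact le_rfl

theorem span_genericMinors_le_rankOrderIdeal :
    Ideal.span (genericMinors K p q (k + 1)) ≤ rankOrderIdeal K p q k 1 := by
  rw [Ideal.span_le]
  rintro _ ⟨r, c, -, -, rfl⟩
  rw [SetLike.mem_coe, mem_rankOrderIdeal, pow_one, Polynomial.X_dvd_iff]
  change Polynomial.constantCoeff ((rankSubst K p q k) _) = 0
  rw [AlgHom.map_det, RingHom.map_det]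
  rw [← det_mul_eq_zero_of_card
    (Matrix.of fun a l => (X (.inl (r a, l)) :
      MvPolynomial ((Fin p × Fin k) ⊕ (Fin k × Fin q) ⊕ (Fin p × Fin q)) K))
    (Matrix.of fun l b => X (.inr (.inl (l, c b))))]
  congr 1
  ext1 a b
  simp [rankSubst, Matrix.mul_apply]

theorem genericMinor_notMem_rankOrderIdeal {r : Fin k → Fin p} {c : Fin k → Fin q}
    (hr : Function.Injective r) (hc : Function.Injective c) :
    genericMinor K r c ∉ rankOrderIdeal K p q k 1 := by
  intro h
  have := pow_dvd_aeval_of_mem_rankOrderIdeal h (S := K)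
    (fun i l => if i = r l then 1 else 0) (fun l j => if j = c l then 1 else 0) 0 0
  rw [pow_one, zero_dvd_iff, genericMinor, AlgHom.map_det] at this
  refine one_ne_zero (α := K) ?_
  rw [← this, ← Matrix.det_one (n := Fin k)]
  congr 1
  ext a b
  simp [Matrix.one_apply, hr.eq_iff, hc.eq_iff]

/-! ### Minors and symbolic powers -/

/-- The Sylvester determinant identity, in a block form. -/
theorem det_pow_mul_det_fromBlocks {R m n : Type*} [CommRing R] [Fintype m] [Fintype n]
    [DecidableEq m] [DecidableEq n] (A : Matrix n n R) (B : Matrix n m R) (C : Matrix m n R)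
    (D : Matrix m m R) :
    A.det ^ Fintype.card m * (Matrix.fromBlocks A B C D).det =
      A.det * (A.det • D - C * A.adjugate * B).det := by
  have h : Matrix.fromBlocks 1 0 (-(C * A.adjugate)) (A.det • 1) * Matrix.fromBlocks A B C D =
      Matrix.fromBlocks A B 0 (A.det • D - C * A.adjugate * B) := by
    rw [Matrix.fromBlocks_multiply]
    congr 1
    · simp
    · simp
    · simp [Matrix.mul_assoc, Matrix.adjugate_mul]
    · simp; abel
  have := congrArg Matrix.det h
  rw [Matrix.det_mul, Matrix.det_fromBlocks_zero₁₂, Matrix.det_fromBlocks_zero₂₁] at this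
  simpa using this

theorem det_mem_pow {R : Type*} [CommRing R] {I : Ideal R} {g : ℕ}
    {M : Matrix (Fin g) (Fin g) R} (h : ∀ i j, M i j ∈ I) : M.det ∈ I ^ g := by
  rw [Matrix.det_apply]
  refine Ideal.sum_mem _ fun π _ => ?_
  rw [Units.smul_def]
  refine zsmul_mem ?_ _
  have := Ideal.prod_mem_prod (s := Finset.univ) (I := fun _ : Fin g => I)
    (x := fun i => M (π i) i) fun i _ => h _ _
  simpa using this

theorem exists_mul_genericMinor_mem_pow {g : ℕ} {r : Fin (k + g) → Fin p}
    {c : Fin (k + g) → Fin q} (hr : StrictMono r) (hc : StrictMono c) :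
    ∃ s, s ∉ rankOrderIdeal K p q k 1 ∧
      s * genericMinor K r c ∈ Ideal.span (genericMinors K p q (k + 1)) ^ g := by
  have hprime := rankOrderIdeal_one_isPrime (K := K) (p := p) (q := q) (k := k)
  let M : Matrix (Fin (k + g)) (Fin (k + g)) (MvPolynomial (Fin p × Fin q) K) :=
    Matrix.of fun a b => X (r a, c b)
  let A := M.submatrix (Fin.castAdd g) (Fin.castAdd g)
  let B := M.submatrix (Fin.castAdd g) (Fin.natAdd k)
  let C := M.submatrix (Fin.natAdd k) (Fin.castAdd g)
  let D := M.submatrix (Fin.natAdd k) (Fin.natAdd k)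
  have hA : A.det ∉ rankOrderIdeal K p q k 1 :=
    genericMinor_notMem_rankOrderIdeal (r := r ∘ Fin.castAdd g) (c := c ∘ Fin.castAdd g)
      (hr.injective.comp (Fin.castAdd_injective _ _))
      (hc.injective.comp (Fin.castAdd_injective _ _))
  have hM : genericMinor K r c = (Matrix.fromBlocks A B C D).det := by
    rw [genericMinor, ← Matrix.det_submatrix_equiv_self finSumFinEquiv]
    congr 1
    ext (a | a) (b | b) <;> rfl
  let E := A.det • D - C * A.adjugate * B
  have hE : ∀ i j, (A.det • E) i j ∈ Ideal.span (genericMinors K p q (k + 1)) := by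
    intro i j
    let e : Fin g → Fin (k + 1) → Fin (k + g) := fun i a =>
      if h : (a : ℕ) < k then ⟨a, by omega⟩ else Fin.natAdd k i
    have he : ∀ i, StrictMono (e i) := by
      intro i a b hab
      rw [Fin.lt_def] at hab ⊢
      simp only [e]
      split_ifs <;> simp <;> omega
    have h1 := det_pow_mul_det_fromBlocks A (B.submatrix id fun _ : Fin 1 => j)
      (C.submatrix (fun _ : Fin 1 => i) id) (D.submatrix (fun _ => i) fun _ => j)
    have h2 : (A.det • D.submatrix (fun _ : Fin 1 => i) (fun _ : Fin 1 => j) -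
        C.submatrix (fun _ : Fin 1 => i) id * A.adjugate *
          B.submatrix id fun _ : Fin 1 => j).det = E i j := by
      rw [Matrix.det_fin_one]; rfl
    have h3 : (Matrix.fromBlocks A (B.submatrix id fun _ : Fin 1 => j)
        (C.submatrix (fun _ : Fin 1 => i) id) (D.submatrix (fun _ => i) fun _ => j)).det =
        genericMinor K (r ∘ e i) (c ∘ e j) := by
      rw [genericMinor, ← Matrix.det_submatrix_equiv_self finSumFinEquiv]
      congr 1
      ext1 a b
      rcases a with a | a <;> rcases b with b | b <;>
        simp [A, B, C, D, M, e] <;> first | rfl | exact ⟨rfl, rfl⟩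
    rw [h2, h3] at h1
    rw [Matrix.smul_apply, smul_eq_mul, ← h1]
    exact Ideal.mul_mem_left _ _ (Ideal.subset_span
      ⟨_, _, (hr.comp (he i)).injective, (hc.comp (he j)).injective, rfl⟩)
  refine ⟨A.det ^ g * A.det ^ g, fun h => ?_, ?_⟩
  · rcases hprime.mem_or_mem h with h | h <;> exact hA (hprime.mem_of_pow_mem _ h)
  · have h1 := det_pow_mul_det_fromBlocks A B C D
    rw [Fintype.card_fin] at h1
    have h2 : A.det ^ g * E.det = (A.det • E).det := by simp
    rw [hM, mul_assoc, h1, mul_left_comm]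
    change A.det * (A.det ^ g * E.det) ∈ _
    rw [h2]
    exact Ideal.mul_mem_left _ _ (det_mem_pow hE)

theorem IsWeightedMinorProduct.exists_mul_mem_pow {n : ℕ} {f : MvPolynomial (Fin p × Fin q) K}
    (hf : IsWeightedMinorProduct K p q k n f) :
    ∃ s, s ∉ rankOrderIdeal K p q k 1 ∧
      s * f ∈ Ideal.span (genericMinors K p q (k + 1)) ^ n := by
  have hprime := rankOrderIdeal_one_isPrime (K := K) (p := p) (q := q) (k := k)
  have h1 : (1 : MvPolynomial (Fin p × Fin q) K) ∉ rankOrderIdeal K p q k 1 := fun h =>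
    hprime.ne_top ((Ideal.eq_top_iff_one _).2 h)
  induction hf with
  | one => exact ⟨1, h1, by simp⟩
  | @mul n s g f r c hr hc hg _ ih =>
    obtain ⟨a, ha, haf⟩ := ih
    obtain ⟨b, hb, hbm⟩ : ∃ b, b ∉ rankOrderIdeal K p q k 1 ∧
        b * genericMinor K r c ∈ Ideal.span (genericMinors K p q (k + 1)) ^ g := by
      rcases le_total s k with hs | hs
      · obtain rfl : g = 0 := by omega
        exact ⟨1, h1, by simp⟩
      · obtain ⟨g', rfl⟩ := Nat.exists_eq_add_of_le hs
        obtain ⟨b, hb, hbm⟩ := exists_mul_genericMinor_mem_pow (K := K) hr hc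
        exact ⟨b, hb, Ideal.pow_le_pow_right (by omega) hbm⟩
    refine ⟨b * a, fun h => (hprime.mem_or_mem h).elim hb ha, ?_⟩
    rw [pow_add, mul_mul_mul_comm]
    exact Ideal.mul_mem_mul hbm haf

theorem IsWeightedMinorProduct.mem_rankOrderIdeal {n : ℕ} {f : MvPolynomial (Fin p × Fin q) K}
    (hf : IsWeightedMinorProduct K p q k n f) : f ∈ rankOrderIdeal K p q k n := by
  obtain ⟨s, hs, hsf⟩ := hf.exists_mul_mem_pow
  exact mem_rankOrderIdeal_of_mul_mem hs (rankOrderIdeal_one_pow_le n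
    (Ideal.pow_right_mono span_genericMinors_le_rankOrderIdeal n hsf))

theorem minorProductIdeal_one_le :
    minorProductIdeal K p q k 1 ≤ Ideal.span (genericMinors K p q (k + 1)) := by
  refine Ideal.span_le.2 ?_
  rintro f ⟨n, hn, hf⟩
  induction hf with
  | one => omega
  | @mul n s g f r c hr hc hg _ ih =>
    rcases Nat.eq_zero_or_pos g with rfl | hg0
    · exact Ideal.mul_mem_left _ _ (ih (by omega))
    · obtain ⟨e, rfl⟩ : ∃ e, s = (k + 1) + e := ⟨s - (k + 1), by omega⟩
      have := genericMinor_mem_pow_mul (Ideal.span (genericMinors K p q (k + 1)))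
        (fun r c hr hc => Ideal.subset_span ⟨r, c, hr.injective, hc.injective, rfl⟩) e hr hc
      exact Ideal.mul_mem_right _ _ (Ideal.mul_le_right this)
end

theorem coeff_prod_pow_of_natDegree_le {σ S : Type*} [CommRing S] (s : Finset σ)
    {G : σ → Polynomial S} {w : σ → ℕ} (hG : ∀ x, (G x).natDegree ≤ w x) (β : σ → ℕ) :
    (∏ x ∈ s, G x ^ β x).natDegree ≤ ∑ x ∈ s, β x * w x ∧
      (∏ x ∈ s, G x ^ β x).coeff (∑ x ∈ s, β x * w x) = ∏ x ∈ s, (G x).coeff (w x) ^ β x := by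
  classical
  induction s using Finset.induction_on with
  | empty => simp
  | insert a s ha ih =>
    rw [Finset.prod_insert ha, Finset.sum_insert ha, Finset.prod_insert ha]
    have h := Polynomial.natDegree_pow_le_of_le (β a) (hG a)
    refine ⟨Polynomial.natDegree_mul_le_of_le h ih.1, ?_⟩
    rw [Polynomial.coeff_mul_add_eq_of_natDegree_le h ih.1, ih.2,
      Polynomial.coeff_pow_of_natDegree_le (hG a)]

/-- If `α` is the only exponent of maximal weight of `f`, then it determines the coefficient of the
maximal degree after the substitution of polynomials of degree at most the weights. -/
theorem coeff_aeval_weight {σ S K : Type*} [Fintype σ] [CommRing K] [CommRing S] [Algebra K S]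
    {G : σ → Polynomial S} {w : σ → ℕ} (hG : ∀ x, (G x).natDegree ≤ w x) {f : MvPolynomial σ K}
    {α : σ →₀ ℕ} (hα : ∀ β ∈ f.support, β ≠ α → Finsupp.weight w β < Finsupp.weight w α) :
    (aeval G f).coeff (Finsupp.weight w α) =
      algebraMap K S (coeff α f) * ∏ x, (G x).coeff (w x) ^ α x := by
  have hw : ∀ β : σ →₀ ℕ, Finsupp.weight w β = ∑ x, β x * w x := fun β => by
    rw [Finsupp.weight_apply, Finsupp.sum_fintype _ _ (by simp)]; simp
  rw [aeval_def, eval₂_eq', Polynomial.finsetSum_coeff, Finset.sum_eq_single α]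
  · rw [Polynomial.algebraMap_apply, Polynomial.coeff_C_mul, hw,
      (coeff_prod_pow_of_natDegree_le _ hG _).2]
  · intro β hβ hne
    rw [Polynomial.algebraMap_apply, Polynomial.coeff_C_mul,
      Polynomial.coeff_eq_zero_of_natDegree_lt, mul_zero]
    refine (coeff_prod_pow_of_natDegree_le _ hG _).1.trans_lt ?_
    rw [← hw]
    exact hα β hβ hne
  · intro h
    rw [notMem_support_iff.1 h]
    simp

theorem le_sum_of_X_pow_dvd_mul_prod {σ S : Type*} [CommRing S] [IsDomain S] [Fintype σ] {n : ℕ}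
    {c : Polynomial S} (hc : c.coeff 0 ≠ 0) (B : σ → S) (α : σ → ℕ)
    [DecidablePred fun x => B x = 0]
    (h : Polynomial.X ^ n ∣ c * ∏ x, (Polynomial.X + Polynomial.C (B x)) ^ α x) :
    n ≤ ∑ x, if B x = 0 then α x else 0 := by
  have h1 : ∏ x, (Polynomial.X + Polynomial.C (B x)) ^ α x =
      Polynomial.X ^ (∑ x, if B x = 0 then α x else 0) *
        ∏ x, (if B x = 0 then 1 else (Polynomial.X + Polynomial.C (B x)) ^ α x) := by
    rw [← Finset.prod_pow_eq_pow_sum, ← Finset.prod_mul_distrib]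
    refine Finset.prod_congr rfl fun x _ => ?_
    split_ifs with hx <;> simp [hx]
  rw [h1, mul_left_comm] at h
  by_contra! hlt
  obtain ⟨d, hd⟩ := Nat.exists_eq_add_of_lt hlt
  rw [hd, add_assoc, pow_add, mul_dvd_mul_iff_left (pow_ne_zero _ Polynomial.X_ne_zero)] at h
  have h2 := (dvd_pow_self _ (Nat.succ_ne_zero d)).trans h
  rw [Polynomial.X_dvd_iff, Polynomial.mul_coeff_zero, Polynomial.coeff_zero_prod] at h2
  refine mul_ne_zero hc (Finset.prod_ne_zero_iff.2 fun x _ => ?_) h2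
  split_ifs with hx
  · simp
  · rw [Polynomial.coeff_zero_eq_eval_zero]; simp [hx]

section
variable {K : Type*} [Field K] {p q k : ℕ}

/-- A bound on the exponent of the leading monomial of a polynomial vanishing to order `n` along the
matrices of rank at most `k`. -/
theorem le_sum_of_mem_rankOrderIdeal {n : ℕ} {f : MvPolynomial (Fin p × Fin q) K}
    (hf : f ∈ rankOrderIdeal K p q k n) {w : Fin p × Fin q → ℕ} {α : Fin p × Fin q →₀ ℕ}
    (hα : coeff α f ≠ 0)
    (hmax : ∀ β ∈ f.support, β ≠ α → Finsupp.weight w β < Finsupp.weight w α)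
    {F : Fin k → Set (Fin p × Fin q)} {u : Fin k → Fin p → ℕ} {v : Fin k → Fin q → ℕ}
    (hle : ∀ l x, u l x.1 + v l x.2 ≤ w x) (heq : ∀ l, ∀ x ∈ F l, u l x.1 + v l x.2 = w x)
    [DecidablePred (· ∈ ⋃ l, F l)] :
    n ≤ ∑ x, if x ∈ ⋃ l, F l then 0 else α x := by
  classical
  let G : Fin p × Fin q → Polynomial (Polynomial (MvPolynomial (Fin k) K)) := fun x =>
    ∑ l, (Polynomial.C (Polynomial.C (X l)) * Polynomial.X ^ u l x.1) * Polynomial.X ^ v l x.2 +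
      Polynomial.C Polynomial.X * Polynomial.X ^ w x
  let B : Fin p × Fin q → MvPolynomial (Fin k) K := fun x =>
    ∑ l, if u l x.1 + v l x.2 = w x then X l else 0
  have hG : ∀ x, G x = ∑ l, Polynomial.C (Polynomial.C (X l)) * Polynomial.X ^ (u l x.1 + v l x.2) +
      Polynomial.C Polynomial.X * Polynomial.X ^ w x := fun x => by
    simp only [G, pow_add, mul_assoc]
  have hdeg : ∀ x, (G x).natDegree ≤ w x := fun x => by
    rw [hG]
    refine Polynomial.natDegree_add_le_of_degree_le
      (Polynomial.natDegree_sum_le_of_forall_le _ _ fun l _ => ?_)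
      (Polynomial.natDegree_C_mul_X_pow_le _ _)
    exact (Polynomial.natDegree_C_mul_X_pow_le _ _).trans (hle l x)
  have hcoeff : ∀ x, (G x).coeff (w x) = Polynomial.X + Polynomial.C (B x) := fun x => by
    rw [hG, Polynomial.coeff_add, Polynomial.finsetSum_coeff, Polynomial.coeff_C_mul_X_pow,
      if_pos rfl, add_comm, map_sum]
    congr 1
    refine Finset.sum_congr rfl fun l _ => ?_
    rw [Polynomial.coeff_C_mul_X_pow, apply_ite Polynomial.C, map_zero]
    simp only [eq_comm]
  have hB : ∀ x, x ∈ ⋃ l, F l → B x ≠ 0 := fun x hx h0 => by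
    obtain ⟨l, hl⟩ := Set.mem_iUnion.1 hx
    have := congrArg (coeff (Finsupp.single l 1)) h0
    simp only [B, coeff_sum, apply_ite (coeff (Finsupp.single l 1)), coeff_zero] at this
    rw [Finset.sum_eq_single l (fun b _ hb => by
      rw [coeff_X, if_neg fun h => hb (Finsupp.single_left_injective one_ne_zero h), ite_self])
      (by simp), if_pos (heq l x hl), coeff_X] at this
    simp at this
  have hdvd := pow_dvd_aeval_of_mem_rankOrderIdeal hf
    (fun i l => Polynomial.C (Polynomial.C (X l)) * Polynomial.X ^ u l i)
    (fun l j => Polynomial.X ^ v l j) (fun x => Polynomial.X ^ w x)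
    (Polynomial.C Polynomial.X : Polynomial (Polynomial (MvPolynomial (Fin k) K)))
  rw [← Polynomial.C_pow, Polynomial.C_dvd_iff_dvd_coeff] at hdvd
  have h1 := hdvd (Finsupp.weight w α)
  rw [coeff_aeval_weight (G := G) hdeg hmax] at h1
  simp only [hcoeff] at h1
  refine (le_sum_of_X_pow_dvd_mul_prod ?_ B α h1).trans (Finset.sum_le_sum fun x _ => ?_)
  · simpa [Polynomial.algebraMap_apply] using hα
  · split_ifs with h2 h3
    · exact absurd h2 (hB x h3)
    all_goals simp
theorem exists_genericMinor_hasLeadingMonomial {w : Fin p × Fin q → ℕ}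
    (hw : ∀ {s : ℕ} {r : Fin s → Fin p} {c : Fin s → Fin q}, StrictMono r → StrictMono c →
      ∀ {π : Equiv.Perm (Fin s)}, π ≠ 1 → ∑ a, w (r (π a), c a) < ∑ a, w (r a, c a))
    {L : List (Fin p × Fin q)} (hL : L.Pairwise fun x y => x.1 < y.1 ∧ x.2 < y.2) :
    ∃ (r : Fin L.length → Fin p) (c : Fin L.length → Fin q), StrictMono r ∧ StrictMono c ∧
      HasLeadingMonomial w (Multiset.toFinsupp (L : Multiset (Fin p × Fin q)))
        (genericMinor K r c) := by
  have hr : StrictMono fun a => (L.get a).1 := fun a b hab => (List.pairwise_iff_get.1 hL a b hab).1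
  have hc : StrictMono fun a => (L.get a).2 := fun a b hab => (List.pairwise_iff_get.1 hL a b hab).2
  refine ⟨_, _, hr, hc, ?_⟩
  have h : Multiset.toFinsupp (L : Multiset (Fin p × Fin q)) =
      ∑ a, Finsupp.single ((L.get a).1, (L.get a).2) 1 := by
    have hsum := Fin.sum_univ_fun_getElem L fun x => ({x} : Multiset (Fin p × Fin q))
    rw [← Multiset.sum_coe, ← Multiset.map_coe, Multiset.sum_map_singleton] at hsum
    rw [← hsum, map_sum]
    simp
  rw [h]
  exact hasLeadingMonomial_genericMinor fun π hπ => hw hr hc hπ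

theorem exists_isWeightedMinorProduct_hasLeadingMonomial {w : Fin p × Fin q → ℕ}
    (hw : ∀ {s : ℕ} {r : Fin s → Fin p} {c : Fin s → Fin q}, StrictMono r → StrictMono c →
      ∀ {π : Equiv.Perm (Fin s)}, π ≠ 1 → ∑ a, w (r (π a), c a) < ∑ a, w (r a, c a))
    {ι : Type*} (s : Finset ι) (L : ι → List (Fin p × Fin q))
    (hL : ∀ i, (L i).Pairwise fun x y => x.1 < y.1 ∧ x.2 < y.2) :
    ∃ f : MvPolynomial (Fin p × Fin q) K,
      IsWeightedMinorProduct K p q k (∑ i ∈ s, ((L i).length - k)) f ∧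
      HasLeadingMonomial w
        (Multiset.toFinsupp (∑ i ∈ s, (L i : Multiset (Fin p × Fin q)))) f := by
  classical
  induction s using Finset.induction_on with
  | empty => exact ⟨1, .one, by simpa using HasLeadingMonomial.one w⟩
  | insert a s ha ih =>
    obtain ⟨f, hf, hlead⟩ := ih
    obtain ⟨r, c, hr, hc, hrc⟩ := exists_genericMinor_hasLeadingMonomial (K := K) hw (hL a)
    rw [Finset.sum_insert ha, Finset.sum_insert ha, map_add]
    exact ⟨_, .mul r c hr hc le_rfl hf, hrc.mul hlead⟩

theorem minorProductIdeal_le_rankOrderIdeal (n : ℕ) :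
    minorProductIdeal K p q k n ≤ rankOrderIdeal K p q k n := by
  refine Ideal.span_le.2 ?_
  rintro f ⟨m, hm, hf⟩
  exact mem_rankOrderIdeal.2 ((pow_dvd_pow _ hm).trans (mem_rankOrderIdeal.1 hf.mem_rankOrderIdeal))

theorem rankOrderIdeal_le_minorProductIdeal (n : ℕ) :
    rankOrderIdeal K p q k n ≤ minorProductIdeal K p q k n := by
  classical
  intro f hf
  obtain ⟨w, hw, hpot, hinj⟩ := exists_weight p q (f.support.sup Finsupp.degree)
  set d := f.support.sup Finsupp.degree with hd
  suffices H : ∀ (W : ℕ) (g : MvPolynomial (Fin p × Fin q) K), g ∈ rankOrderIdeal K p q k n →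
      (∀ β ∈ g.support, β.degree ≤ d ∧ Finsupp.weight w β < W) →
      g ∈ minorProductIdeal K p q k n by
    refine H (f.support.sup (Finsupp.weight w) + 1) f hf fun β hβ => ⟨?_, ?_⟩
    · exact Finset.le_sup (f := Finsupp.degree) hβ
    · exact Nat.lt_succ_of_le (Finset.le_sup (f := Finsupp.weight w) hβ)
  intro W
  induction W with
  | zero =>
    intro g _ hg
    rw [support_eq_empty.1 (Finset.eq_empty_of_forall_notMem fun β hβ =>
      absurd (hg β hβ).2 (Nat.not_lt_zero _))]
    exact zero_mem _
  | succ W ih =>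
    intro g hgK hg
    by_cases hex : ∃ α ∈ g.support, Finsupp.weight w α = W
    · obtain ⟨α, hα, hαW⟩ := hex
      have hmax : ∀ β ∈ g.support, β ≠ α → Finsupp.weight w β < Finsupp.weight w α := by
        intro β hβ hne
        have := (hg β hβ).2
        have : Finsupp.weight w β ≠ Finsupp.weight w α := fun h =>
          hne (hinj β α (hg β hβ).1 (hg α hα).1 h)
        omega
      obtain ⟨ι, _, L, hL, hsum, hn⟩ := exists_chains
        (fun x y : Fin p × Fin q => x.1 < y.1 ∧ x.2 < y.2) (fun x => (x.1 : ℕ)) p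
        (fun x => x.1.2.le) (fun x y h => h.1)
        (fun x y z h h' => ⟨h.1.trans h'.1, h.2.trans h'.2⟩) α k n (fun F hF => by
          choose u v hle heq using fun l => hpot (F l) (hF l)
          convert le_sum_of_mem_rankOrderIdeal hgK (mem_support_iff.1 hα) hmax hle heq)
      obtain ⟨P, hP, hlead⟩ := exists_isWeightedMinorProduct_hasLeadingMonomial (K := K) (k := k)
        hw Finset.univ L hL
      rw [hsum, Finsupp.toMultiset_toFinsupp] at hlead
      have hPJ : P ∈ minorProductIdeal K p q k n := Ideal.subset_span ⟨_, hn, hP⟩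
      have hlead' := (mem_restrictSupport_iff _).1 hlead
      have hsub : g - C (coeff α g) * P ∈ minorProductIdeal K p q k n := by
        refine ih _ (sub_mem hgK (Ideal.mul_mem_left _ _
          (minorProductIdeal_le_rankOrderIdeal n hPJ))) fun β hβ => ?_
        have hcoeff : coeff β (g - C (coeff α g) * P) =
            coeff β (g - monomial α (coeff α g)) - coeff α g * coeff β (P - monomial α 1) := by
          simp only [coeff_sub, coeff_C_mul, coeff_monomial]
          split_ifs <;> ring
        rw [mem_support_iff, hcoeff] at hβ
        by_cases hβP : β ∈ (P - monomial α 1).support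
        · have := hlead' hβP
          have := (hg α hα).1
          simp only [Set.mem_ofPred_eq] at *
          omega
        · rw [notMem_support_iff.1 hβP, mul_zero, sub_zero, coeff_sub, coeff_monomial] at hβ
          have hne : β ≠ α := fun h => hβ (by simp [h])
          rw [if_neg hne.symm, sub_zero] at hβ
          have hβg := mem_support_iff.2 hβ
          have := hmax β hβg hne
          exact ⟨(hg β hβg).1, by omega⟩
      have := add_mem hsub (Ideal.mul_mem_left _ (C (coeff α g)) hPJ)
      rwa [sub_add_cancel] at this
    · push Not at hex
      refine ih g hgK fun β hβ => ⟨(hg β hβ).1, ?_⟩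
      have := (hg β hβ).2
      have := hex β hβ
      omega

theorem span_genericMinors_eq_rankOrderIdeal :
    Ideal.span (genericMinors K p q (k + 1)) = rankOrderIdeal K p q k 1 :=
  le_antisymm span_genericMinors_le_rankOrderIdeal
    ((rankOrderIdeal_le_minorProductIdeal 1).trans minorProductIdeal_one_le)

theorem mem_symbolicPower_iff_of_isPrime {R : Type*} [CommRing R] [IsNoetherianRing R]
    {I : Ideal R} (hI : I.IsPrime) {n : ℕ} {f : R} :
    f ∈ symbolicPower I n ↔ ∃ s, s ∉ I ∧ s * f ∈ I ^ n := by
  change (∀ P ∈ associatedPrimes R (R ⧸ I), ∃ s, s ∉ P ∧ s * f ∈ I ^ n) ↔ _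
  rw [associatedPrimes.eq_singleton_of_isPrimary hI.isPrimary, hI.radical]
  simp

theorem symbolicPower_span_genericMinors (n : ℕ) :
    symbolicPower (Ideal.span (genericMinors K p q (k + 1))) n = minorProductIdeal K p q k n := by
  have hI : (Ideal.span (genericMinors K p q (k + 1))).IsPrime := by
    rw [span_genericMinors_eq_rankOrderIdeal]; exact rankOrderIdeal_one_isPrime
  refine le_antisymm (fun f hf => ?_) (Ideal.span_le.2 ?_)
  · obtain ⟨s, hs, hsf⟩ := (mem_symbolicPower_iff_of_isPrime hI).1 hf
    rw [span_genericMinors_eq_rankOrderIdeal] at hs hsf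
    exact rankOrderIdeal_le_minorProductIdeal n
      (mem_rankOrderIdeal_of_mul_mem hs (rankOrderIdeal_one_pow_le n hsf))
  · rintro f ⟨m, hm, hf⟩
    obtain ⟨s, hs, hsf⟩ := hf.exists_mul_mem_pow
    rw [← span_genericMinors_eq_rankOrderIdeal] at hs
    exact (mem_symbolicPower_iff_of_isPrime hI).2 ⟨s, hs, Ideal.pow_le_pow_right hm hsf⟩
end

end

/-- **Remark `rmk.HHgeneralDI`.** Let `I = I_t(X)` be the ideal of `t`-minors of a generic
`p×q` matrix of indeterminates, of height `h = (p−t+1)(q−t+1)`.  Then for all `m, r, c ≥ 1`,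
`I^{(r(m+h−1)−h+c)} ⊆ 𝔪^{(r−1)(h−1)+c−1} (I^{(m)})^r`. -/
theorem stmt_14 {k : Type*} [Field k] (p q t : ℕ) (ht : 1 ≤ t) (htp : t ≤ p) (htq : t ≤ q)
    (h : ℕ) (hh : h = (p - t + 1) * (q - t + 1)) :
    ∀ m r c : ℕ, 1 ≤ m → 1 ≤ r → 1 ≤ c →
      symbolicPower (Ideal.span (genericMinors k p q t)) (r * (m + h - 1) - h + c) ≤
        (Ideal.span (Set.range
            (MvPolynomial.X : Fin p × Fin q → MvPolynomial (Fin p × Fin q) k)))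
            ^ ((r - 1) * (h - 1) + c - 1) *
          (symbolicPower (Ideal.span (genericMinors k p q t)) m) ^ r := by
  intro m r c hm hr hc
  obtain ⟨t, rfl⟩ := Nat.exists_eq_add_of_le' ht
  obtain ⟨r, rfl⟩ := Nat.exists_eq_add_of_le' hr
  have hle : p - (t + 1) + 1 ≤ h := hh ▸ Nat.le_mul_of_pos_right _ (Nat.succ_pos _)
  obtain ⟨e, rfl⟩ : ∃ e, h = e + 1 := ⟨h - 1, by omega⟩
  have hN : (r + 1) * (m + (e + 1) - 1) - (e + 1) + c =
      (r + 1) * m + ((r + 1 - 1) * (e + 1 - 1) + c - 1) := by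
    have h1 : (r + 1) * (m + (e + 1) - 1) = (r + 1) * m + r * e + e := by
      rw [← add_assoc, Nat.add_sub_cancel]; ring
    have h2 : 1 ≤ (r + 1) * m := Nat.mul_pos r.succ_pos hm
    rw [h1, Nat.add_sub_cancel, Nat.add_sub_cancel]
    omega
  rw [hN, symbolicPower_span_genericMinors, symbolicPower_span_genericMinors]
  refine minorProductIdeal_le_pow_mul (e := e) hm (by omega) ?_
  rw [Nat.add_sub_cancel, Nat.add_sub_cancel]
  omega
end

section
/- Let k be a field of arbitrary characteristic and let t ≤ min{p,q} be positive integers. Let X = (x_{ij}) be a p×q matrix of indeterminates, R = k[x_{ij}] the polynomial ring with maximal homogeneous ideal 𝔪, and I = I_t(X) the ideal generated by the determinants of all t×t submatrices of X. Then for every integer m ≥ 1 one has the containment I^{(m+1)} ⊆ 𝔪 · I^{(m)} (and consequently I^{(m+c−1)} ⊆ 𝔪^{c−1} · I^{(m)} for all c ≥ 1). -/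
namespace GenericMinors

section Translation

variable {k : Type*} [CommRing k] {N : ℕ}

variable (k N) in
/-- The substitution `y_j ↦ y_j + c`, where `c` is the new polynomial variable. -/
noncomputable def translate :
    MvPolynomial (Fin N) k →ₐ[k] Polynomial (MvPolynomial (Fin N) k) :=
  MvPolynomial.aeval fun j => Polynomial.C (MvPolynomial.X j) + Polynomial.X

lemma translate_X (j : Fin N) :
    translate k N (MvPolynomial.X j) = Polynomial.C (MvPolynomial.X j) + Polynomial.X := by
  simp [translate]

lemma translate_injective : Function.Injective (translate k N) := by
  have h : (Polynomial.evalRingHom 0).comp (translate k N).toRingHom = RingHom.id _ := by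
    apply MvPolynomial.ringHom_ext
    · intro a
      simp [translate, IsScalarTower.algebraMap_apply k (MvPolynomial (Fin N) k)
        (Polynomial (MvPolynomial (Fin N) k)), MvPolynomial.algebraMap_eq]
    · intro j
      simp [translate]
  exact Function.LeftInverse.injective (g := Polynomial.evalRingHom 0)
    fun f => congrArg (fun F => F f) h

lemma degreeOf_coeff_mul_le (i : Fin N) {P Q : Polynomial (MvPolynomial (Fin N) k)}
    {v w : ℕ} (hP : ∀ n, (P.coeff n).degreeOf i ≤ v) (hQ : ∀ n, (Q.coeff n).degreeOf i ≤ w)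
    (n : ℕ) : ((P * Q).coeff n).degreeOf i ≤ v + w := by
  rw [Polynomial.coeff_mul]
  refine (MvPolynomial.degreeOf_sum_le _ _ _).trans (Finset.sup_le fun x _ => ?_)
  exact (MvPolynomial.degreeOf_mul_le _ _ _).trans (add_le_add (hP _) (hQ _))

lemma degreeOf_coeff_pow_le (i : Fin N) {P : Polynomial (MvPolynomial (Fin N) k)} {v : ℕ}
    (hP : ∀ n, (P.coeff n).degreeOf i ≤ v) (e n : ℕ) :
    ((P ^ e).coeff n).degreeOf i ≤ e * v := by
  induction e generalizing n with
  | zero =>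
    rw [pow_zero, Polynomial.coeff_one]
    split_ifs <;> simp
  | succ e ih =>
    rw [pow_succ, add_mul, one_mul]
    exact degreeOf_coeff_mul_le i ih hP n

lemma degreeOf_coeff_prod_le {ι : Type*} (i : Fin N) (s : Finset ι)
    {P : ι → Polynomial (MvPolynomial (Fin N) k)} {v : ι → ℕ}
    (hP : ∀ j n, ((P j).coeff n).degreeOf i ≤ v j) (n : ℕ) :
    ((∏ j ∈ s, P j).coeff n).degreeOf i ≤ ∑ j ∈ s, v j := by
  classical
  induction s using Finset.induction_on generalizing n with
  | empty =>
    rw [Finset.prod_empty, Polynomial.coeff_one]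
    split_ifs <;> simp
  | insert a s ha ih =>
    rw [Finset.prod_insert ha, Finset.sum_insert ha]
    exact degreeOf_coeff_mul_le i (hP a) ih n

lemma degreeOf_coeff_translate_le (i : Fin N) (g : MvPolynomial (Fin N) k) (n : ℕ) :
    ((translate k N g).coeff n).degreeOf i ≤ g.degreeOf i := by
  conv_lhs => rw [g.as_sum]
  rw [map_sum, Polynomial.finsetSum_coeff]
  refine (MvPolynomial.degreeOf_sum_le _ _ _).trans (Finset.sup_le fun m hm => ?_)
  rw [translate, MvPolynomial.aeval_monomial, Finsupp.prod_fintype _ _ (by simp)]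
  have hlin : ∀ (j : Fin N) (n : ℕ), ((Polynomial.C (MvPolynomial.X j : MvPolynomial (Fin N) k) +
      Polynomial.X).coeff n).degreeOf i ≤ if i = j then 1 else 0 := by
    intro j n
    cases subsingleton_or_nontrivial k
    · rw [Subsingleton.elim (Polynomial.coeff _ n) 0, MvPolynomial.degreeOf_zero]
      exact Nat.zero_le _
    rw [Polynomial.coeff_add, Polynomial.coeff_C, Polynomial.coeff_X]
    refine (MvPolynomial.degreeOf_add_le _ _ _).trans (max_le ?_ ?_)
    · split_ifs with h h' <;> simp_all [MvPolynomial.degreeOf_X]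
    · split_ifs <;> simp
  have h1 := degreeOf_coeff_prod_le i Finset.univ
    (fun j => degreeOf_coeff_pow_le i (hlin j) (m j))
  have h2 : ∀ n, ((algebraMap k (Polynomial (MvPolynomial (Fin N) k))
      (g.coeff m)).coeff n).degreeOf i ≤ 0 := by
    intro n
    rw [IsScalarTower.algebraMap_apply k (MvPolynomial (Fin N) k), Polynomial.algebraMap_eq,
      Polynomial.coeff_C, MvPolynomial.algebraMap_eq]
    split_ifs <;> simp
  refine (degreeOf_coeff_mul_le i h2 h1 n).trans ?_
  simpa using MvPolynomial.degreeOf_le_iff.1 le_rfl m hm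

/-- Let `r` be the lexicographically smallest exponent of `g`. A bound `d` on the degree in `c` of
`g(y + c)` and bounds `s j` on the degrees of `g` in `y_j` force a ballot condition on `r`. -/
theorem ballot_of_natDegree_translate_le {N : ℕ} (g : MvPolynomial (Fin N) k) (d : ℕ)
    (s : Fin N → ℕ) (r : Fin N →₀ ℕ) (hd : (translate k N g).natDegree ≤ d)
    (hs : ∀ r' ∈ g.support, ∀ j, r' j ≤ s j) (hr : r ∈ g.support)
    (hlex : ∀ r' ∈ g.support, ∀ j, (∀ j' < j, r' j' = r j') → r j ≤ r' j) (i : Fin N) :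
    (∑ j, if j ≤ i then r j else 0) + (∑ j, if j < i then r j else 0) ≤
      d + ∑ j, if j < i then s j else 0 := by
  induction N generalizing d with
  | zero => exact i.elim0
  | succ N ih =>
    have : Nontrivial k := by
      refine ⟨g.coeff r, 0, ?_⟩
      simpa using hr
    set G := MvPolynomial.finSuccEquiv k N g with hG
    have hdvd : Polynomial.X ^ r 0 ∣ G := by
      rw [Polynomial.X_pow_dvd_iff]
      intro e he
      ext m
      rw [hG, MvPolynomial.finSuccEquiv_coeff_coeff, MvPolynomial.coeff_zero]
      by_contra h
      have := hlex (m.cons e) (by simpa using h) 0 (by simp)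
      simp at this
      omega
    obtain ⟨G', hG'⟩ := hdvd
    set g' := (MvPolynomial.finSuccEquiv k N).symm G' with hg'
    have hgg' : g = MvPolynomial.X 0 ^ r 0 * g' := by
      apply (MvPolynomial.finSuccEquiv k N).injective
      rw [map_mul, map_pow, MvPolynomial.finSuccEquiv_X_zero, hg', AlgEquiv.apply_symm_apply,
        ← hG', hG]
    set h := G.coeff (r 0) with hh
    have hh' : h = G'.coeff 0 := by
      rw [hh, hG', Polynomial.coeff_X_pow_mul', if_pos le_rfl, Nat.sub_self]
    have hcoeff : ∀ m, h.coeff m = g.coeff (m.cons (r 0)) := fun m => by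
      rw [hh, hG, MvPolynomial.finSuccEquiv_coeff_coeff]
    have htail : r.tail ∈ h.support := by
      rw [MvPolynomial.mem_support_iff, hcoeff, Finsupp.cons_tail]
      simpa using hr
    have hG'0 : G' ≠ 0 := by
      rintro rfl
      rw [hh', Polynomial.coeff_zero] at htail
      simp at htail
    -- the retraction `y₀ ↦ -c`
    let φ : MvPolynomial (Fin (N + 1)) k →+* Polynomial (MvPolynomial (Fin N) k) :=
      (Polynomial.compRingHom (-Polynomial.X)).comp
        (MvPolynomial.finSuccEquiv k N : _ →+* Polynomial (MvPolynomial (Fin N) k))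
    let ev := Polynomial.eval₂RingHom φ Polynomial.X
    have hev : ev (translate k (N + 1) g') = translate k N h := by
      have key : ev.comp (translate k (N + 1)).toRingHom =
          ((translate k N).toRingHom.comp (Polynomial.evalRingHom 0)).comp
          (MvPolynomial.finSuccEquiv k N : _ →+* Polynomial (MvPolynomial (Fin N) k)) := by
        apply MvPolynomial.ringHom_ext
        · intro a
          simp [ev, φ, translate, MvPolynomial.finSuccEquiv_apply]
        · intro j
          refine Fin.cases ?_ (fun j => ?_) j <;>
            simp [ev, φ, translate, MvPolynomial.finSuccEquiv_X_zero,
              MvPolynomial.finSuccEquiv_X_succ]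
      have := congrArg (fun F => F g') key
      simpa [hh', hg', Polynomial.coeff_zero_eq_eval_zero] using this
    have hT0 : translate k (N + 1) g' ≠ 0 := by
      intro h0
      have := translate_injective (N := N + 1) (h0.trans (map_zero _).symm)
      rw [hg', map_eq_zero_iff _ (MvPolynomial.finSuccEquiv k N).symm.injective] at this
      exact hG'0 this
    have hdeg1 : r 0 + (translate k (N + 1) g').natDegree ≤ d := by
      have hm : ((Polynomial.C (MvPolynomial.X 0 : MvPolynomial (Fin (N + 1)) k) +
          Polynomial.X) ^ r 0).Monic := by
        rw [add_comm (Polynomial.C _)]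
        exact (Polynomial.monic_X_add_C _).pow _
      have : translate k (N + 1) g = (Polynomial.C (MvPolynomial.X 0) + Polynomial.X) ^ r 0 *
          translate k (N + 1) g' := by
        conv_lhs => rw [hgg']
        rw [map_mul, map_pow, translate_X]
      rw [this, hm.natDegree_mul' hT0] at hd
      rwa [add_comm (Polynomial.C _), Polynomial.natDegree_pow_X_add_C] at hd
    have hdeg2 : g'.degreeOf 0 + r 0 ≤ s 0 := by
      have h1 : g.degreeOf 0 ≤ s 0 := MvPolynomial.degreeOf_le_iff.2 fun m hm => hs m hm 0
      rw [← MvPolynomial.natDegree_finSuccEquiv, ← hG, hG',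
        (Polynomial.monic_X_pow _).natDegree_mul' hG'0, Polynomial.natDegree_X_pow] at h1
      rw [← MvPolynomial.natDegree_finSuccEquiv, hg', AlgEquiv.apply_symm_apply]
      omega
    have hdeg3 : (translate k N h).natDegree ≤
        (translate k (N + 1) g').natDegree + g'.degreeOf 0 := by
      rw [← hev]
      change (Polynomial.eval₂ φ Polynomial.X _).natDegree ≤ _
      rw [Polynomial.eval₂_eq_sum_range]
      refine Polynomial.natDegree_sum_le_of_forall_le _ _ fun n hn => ?_
      refine Polynomial.natDegree_mul_le.trans ?_
      rw [Polynomial.natDegree_X_pow, add_comm]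
      refine add_le_add (by simpa [Nat.lt_succ_iff] using hn) ?_
      refine Polynomial.natDegree_comp_le.trans ?_
      rw [Polynomial.natDegree_neg, Polynomial.natDegree_X, mul_one]
      refine (MvPolynomial.natDegree_finSuccEquiv _).le.trans ?_
      exact degreeOf_coeff_translate_le 0 g' n
    have IH := ih h _ (fun j => s j.succ) r.tail le_rfl
      (fun r' hr' j => by
        simpa using hs (r'.cons (r 0)) (by simpa [← hcoeff] using hr') j.succ)
      htail
      (fun r' hr' j hj => by
        have := hlex (r'.cons (r 0)) (by simpa [← hcoeff] using hr') j.succ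
          (fun j' hj' => by
            refine Fin.cases (by simp) (fun j'' h'' => ?_) j' hj'
            simpa [Finsupp.tail_apply] using hj j'' (by simpa using h''))
        simpa [Finsupp.tail_apply] using this)
    simp only [Fin.sum_univ_succ, Fin.zero_le, if_true]
    refine Fin.cases ?_ (fun i => ?_) i
    · simp
      omega
    · have := IH i
      simp only [Finsupp.tail_apply] at this
      simp only [Fin.succ_le_succ_iff, Fin.succ_lt_succ_iff, Fin.succ_pos, if_true]
      omega

end Translation

section CramerMatrix

variable {A B : Type*} [CommRing A] [CommRing B] {p q : ℕ}

/-- The first `q` columns of a `p × (q + p)` matrix. -/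
def leftBlock (Z : Matrix (Fin p) (Fin (q + p)) A) : Matrix (Fin p) (Fin q) A :=
  Z.submatrix id (Fin.castAdd p)

/-- The last `p` columns of a `p × (q + p)` matrix. -/
def rightBlock (Z : Matrix (Fin p) (Fin (q + p)) A) : Matrix (Fin p) (Fin p) A :=
  Z.submatrix id (Fin.natAdd q)

/-- The matrix `adj(Z₂) Z₁`, where `Z = [Z₁ | Z₂]`. -/
def cramerMatrix (Z : Matrix (Fin p) (Fin (q + p)) A) : Matrix (Fin p) (Fin q) A :=
  (rightBlock Z).adjugate * leftBlock Z

/-- The matrix `[M | 1]`. -/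
def augment (M : Matrix (Fin p) (Fin q) A) : Matrix (Fin p) (Fin (q + p)) A :=
  Matrix.of fun i => Fin.append (M i) ((1 : Matrix (Fin p) (Fin p) A) i)

/-- The maximal minor of `M` on the columns `c`. -/
def maxMinor (M : Matrix (Fin p) (Fin (q + p)) A) (c : Fin p → Fin (q + p)) : A :=
  (M.submatrix id c).det

lemma augment_castAdd (M : Matrix (Fin p) (Fin q) A) (i : Fin p) (j : Fin q) :
    augment M i (Fin.castAdd p j) = M i j := by
  simp [augment]

lemma augment_natAdd (M : Matrix (Fin p) (Fin q) A) (i l : Fin p) :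
    augment M i (Fin.natAdd q l) = (1 : Matrix (Fin p) (Fin p) A) i l := by
  simp [augment]

lemma cramerMatrix_map (f : A →+* B) (Z : Matrix (Fin p) (Fin (q + p)) A) :
    cramerMatrix (Z.map f) = (cramerMatrix Z).map f := by
  have := f.map_adjugate (rightBlock Z)
  simp only [RingHom.mapMatrix_apply] at this
  rw [cramerMatrix, cramerMatrix, Matrix.map_mul, this]
  rfl

lemma augment_map (f : A →+* B) (M : Matrix (Fin p) (Fin q) A) :
    augment (M.map f) = (augment M).map f := by
  ext i j
  refine Fin.addCases (fun j => ?_) (fun j => ?_) j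
  · simp [augment_castAdd]
  · simp [augment_natAdd, Matrix.one_apply, apply_ite f]

lemma maxMinor_map (f : A →+* B) (M : Matrix (Fin p) (Fin (q + p)) A)
    (c : Fin p → Fin (q + p)) : maxMinor (M.map f) c = f (maxMinor M c) := by
  rw [maxMinor, maxMinor, f.map_det]
  rfl

lemma cramerMatrix_mul_left (E : Matrix (Fin p) (Fin p) A) (hE : E.det = 1)
    (Z : Matrix (Fin p) (Fin (q + p)) A) : cramerMatrix (E * Z) = cramerMatrix Z := by
  have h1 : rightBlock (E * Z) = E * rightBlock Z := rfl
  have h2 : leftBlock (E * Z) = E * leftBlock Z := rfl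
  rw [cramerMatrix, cramerMatrix, h1, h2, Matrix.adjugate_mul_distrib, Matrix.mul_assoc,
    ← Matrix.mul_assoc E.adjugate, Matrix.adjugate_mul, hE, one_smul, Matrix.one_mul]

lemma cramerMatrix_apply (Z : Matrix (Fin p) (Fin (q + p)) A) (i : Fin p) (j : Fin q) :
    cramerMatrix Z i j =
      ((rightBlock Z).updateCol i fun l => Z l (Fin.castAdd p j)).det := by
  rw [← Matrix.cramer_apply, Matrix.cramer_eq_adjugate_mulVec]
  rfl

/-- The scaling factors relating the columns of `adj(Z₂) Z` to those of `[adj(Z₂) Z₁ | 1]`. -/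
def columnScale (Z : Matrix (Fin p) (Fin (q + p)) A) : Fin (q + p) → A :=
  Fin.append (fun _ => 1) fun _ => (rightBlock Z).det

lemma adjugate_mul_eq_augment (Z : Matrix (Fin p) (Fin (q + p)) A) :
    (rightBlock Z).adjugate * Z = augment (cramerMatrix Z) *
      Matrix.diagonal (columnScale Z) := by
  ext i j
  rw [Matrix.mul_diagonal, columnScale]
  refine Fin.addCases (fun j => ?_) (fun j => ?_) j
  · rw [augment_castAdd, Fin.append_left, mul_one]
    rfl
  · rw [augment_natAdd, Fin.append_right]
    have := congrFun (congrFun (Matrix.adjugate_mul (rightBlock Z)) i) j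
    rw [Matrix.smul_apply, smul_eq_mul, mul_comm] at this
    exact this

lemma det_rightBlock_pow_mul_maxMinor (Z : Matrix (Fin p) (Fin (q + p)) A)
    (c : Fin p → Fin (q + p)) :
    (rightBlock Z).det ^ (p - 1) * maxMinor Z c = maxMinor (augment (cramerMatrix Z)) c *
      ∏ l, columnScale Z (c l) := by
  have h := congrArg (fun M => (M.submatrix id c).det) (adjugate_mul_eq_augment Z)
  have h1 : ((rightBlock Z).adjugate * Z).submatrix id c =
    (rightBlock Z).adjugate * Z.submatrix id c := rfl
  have h2 (D : Fin (q + p) → A) :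
      (augment (cramerMatrix Z) * Matrix.diagonal D).submatrix id c =
      (augment (cramerMatrix Z)).submatrix id c * Matrix.diagonal (D ∘ c) := by
    ext i j
    simp [Matrix.mul_diagonal]
  simp only [h1, h2, Matrix.det_mul, Matrix.det_adjugate, Matrix.det_diagonal,
    Fintype.card_fin] at h
  exact h

lemma cramerMatrix_augment (M : Matrix (Fin p) (Fin q) A) : cramerMatrix (augment M) = M := by
  have h1 : rightBlock (augment M) = 1 := by
    ext i j
    exact augment_natAdd M i j
  have h2 : leftBlock (augment M) = M := by
    ext i j
    exact augment_castAdd M i j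
  rw [cramerMatrix, h1, h2, Matrix.adjugate_one, Matrix.one_mul]

end CramerMatrix

section CramerHom

variable (k : Type*) [CommRing k] (p q : ℕ)

/-- The generic `p × q` matrix. -/
noncomputable def genericMatrix : Matrix (Fin p) (Fin q) (MvPolynomial (Fin p × Fin q) k) :=
  Matrix.of fun i j => MvPolynomial.X (i, j)

/-- The generic `p × (q + p)` matrix, its variables ordered column by column. -/
noncomputable def genericWide :
    Matrix (Fin p) (Fin (q + p)) (MvPolynomial (Fin (q + p) ×ₗ Fin p) k) :=
  Matrix.of fun i j => MvPolynomial.X (toLex (j, i))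

/-- The substitution `X ↦ adj(Z₂) Z₁`. -/
noncomputable def cramerHom :
    MvPolynomial (Fin p × Fin q) k →ₐ[k] MvPolynomial (Fin (q + p) ×ₗ Fin p) k :=
  MvPolynomial.aeval fun v => cramerMatrix (genericWide k p q) v.1 v.2

variable {k p q}

lemma genericMatrix_map_cramerHom :
    (genericMatrix k p q).map (cramerHom k p q) = cramerMatrix (genericWide k p q) := by
  ext i j
  simp [genericMatrix, cramerHom]

lemma cramerHom_maxMinor (c : Fin p → Fin (q + p)) :
    cramerHom k p q (maxMinor (augment (genericMatrix k p q)) c) =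
      maxMinor (augment (cramerMatrix (genericWide k p q))) c := by
  rw [← genericMatrix_map_cramerHom]
  have := maxMinor_map (cramerHom k p q : _ →+* MvPolynomial (Fin (q + p) ×ₗ Fin p) k)
    (augment (genericMatrix k p q)) c
  rw [← augment_map] at this
  exact this.symm

/-- Two ring homomorphisms that agree on scalars and send the generic wide matrix to matrices
differing by a unimodular row transformation agree on the image of `cramerHom`. -/
lemma map_cramerHom_eq {B : Type*} [CommRing B]
    {f g : MvPolynomial (Fin (q + p) ×ₗ Fin p) k →+* B} (hC : ∀ a, f (.C a) = g (.C a))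
    (E : Matrix (Fin p) (Fin p) B) (hE : E.det = 1)
    (hfg : (genericWide k p q).map f = E * (genericWide k p q).map g)
    (x : MvPolynomial (Fin p × Fin q) k) :
    f (cramerHom k p q x) = g (cramerHom k p q x) := by
  have hM : (cramerMatrix (genericWide k p q)).map f =
      (cramerMatrix (genericWide k p q)).map g := by
    rw [← cramerMatrix_map, ← cramerMatrix_map, hfg, cramerMatrix_mul_left E hE]
  have : f.comp (cramerHom k p q).toRingHom = g.comp (cramerHom k p q).toRingHom := by
    apply MvPolynomial.ringHom_ext
    · intro a
      simpa [cramerHom, MvPolynomial.algebraMap_eq] using hC a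
    · intro v
      simpa [cramerHom] using congrFun (congrFun hM v.1) v.2
  exact congrArg (fun F => F x) this

lemma cramerHom_injective : Function.Injective (cramerHom k p q) := by
  let ρ : MvPolynomial (Fin (q + p) ×ₗ Fin p) k →ₐ[k] MvPolynomial (Fin p × Fin q) k :=
    MvPolynomial.aeval fun v => augment (genericMatrix k p q) (ofLex v).2 (ofLex v).1
  have hρ : (genericWide k p q).map ρ = augment (genericMatrix k p q) := by
    ext i j
    simp [genericWide, ρ]
  have h : ρ.comp (cramerHom k p q) = AlgHom.id _ _ := by
    apply MvPolynomial.algHom_ext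
    intro v
    have := cramerMatrix_map (ρ : _ →+* MvPolynomial (Fin p × Fin q) k) (genericWide k p q)
    have h2 := congrFun (congrFun this v.1) v.2
    change cramerMatrix ((genericWide k p q).map ρ) v.1 v.2 = _ at h2
    rw [hρ, cramerMatrix_augment] at h2
    simpa [cramerHom, genericMatrix] using h2.symm
  exact Function.LeftInverse.injective (g := ρ) fun x => congrArg (fun F => F x) h

/-- In every monomial of `cramerHom f`, each row occurs as often as the first `q` columns. -/
lemma sum_row_eq_of_mem_support_cramerHom (f : MvPolynomial (Fin p × Fin q) k)
    {a : Fin (q + p) ×ₗ Fin p →₀ ℕ} (ha : a ∈ (cramerHom k p q f).support) (i : Fin p) :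
    ∑ j, a (toLex (j, i)) = ∑ l : Fin p, ∑ j : Fin q, a (toLex (Fin.castAdd p j, l)) := by
  let w : Fin (q + p) ×ₗ Fin p → ℤ := fun v =>
    (Pi.single i 1 : Fin p → ℤ) (ofLex v).2 + Fin.append (fun _ : Fin q => (-1 : ℤ)) 0 (ofLex v).1
  have hX : ∀ v : Fin p × Fin q, MvPolynomial.IsWeightedHomogeneous w
      (cramerMatrix (genericWide k p q) v.1 v.2) 0 := by
    intro v
    rw [cramerMatrix_apply, Matrix.det_apply]
    refine MvPolynomial.IsWeightedHomogeneous.sum _ _ _ fun τ _ => ?_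
    have h1 : MvPolynomial.IsWeightedHomogeneous w (∏ l, (rightBlock (genericWide k p q)).updateCol
        v.1 (fun l => genericWide k p q l (Fin.castAdd p v.2)) (τ l) l)
        (∑ l, ((Pi.single i 1 : Fin p → ℤ) (τ l) + if l = v.1 then -1 else 0)) := by
      refine MvPolynomial.IsWeightedHomogeneous.prod _ _ _ fun l _ => ?_
      by_cases h : l = v.1
      · have := MvPolynomial.isWeightedHomogeneous_X k w (toLex (Fin.castAdd p v.2, τ l))
        convert this using 1
        · simp [h, genericWide]
        · simp [w, h]
      · have := MvPolynomial.isWeightedHomogeneous_X k w (toLex (Fin.natAdd q l, τ l))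
        convert this using 1
        · simp [h, rightBlock, genericWide]
        · simp [w, h]
    have h2 : ∑ l, ((Pi.single i 1 : Fin p → ℤ) (τ l) + if l = v.1 then -1 else 0) = (0 : ℤ) := by
      rw [Finset.sum_add_distrib, Equiv.sum_comp τ (Pi.single i 1 : Fin p → ℤ)]
      simp
    rw [h2] at h1
    rw [Units.smul_def]
    exact (MvPolynomial.weightedHomogeneousSubmodule k w 0).toAddSubgroup.zsmul_mem h1 _
  have hf : MvPolynomial.IsWeightedHomogeneous w (cramerHom k p q f) 0 := by
    clear ha
    induction f using MvPolynomial.induction_on with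
    | C a => simpa [cramerHom] using MvPolynomial.isWeightedHomogeneous_C w a
    | add f g hf hg =>
      rw [map_add]
      exact hf.add hg
    | mul_X f v hf =>
      rw [map_mul, ← add_zero (0 : ℤ)]
      refine hf.mul ?_
      simpa [cramerHom] using hX v
  have := hf (MvPolynomial.mem_support_iff.1 ha)
  rw [Finsupp.weight_apply, Finsupp.sum_fintype _ _ (by simp)] at this
  rw [← (toLex (α := Fin (q + p) × Fin p)).sum_comp, Fintype.sum_prod_type] at this
  simp only [w, ofLex_toLex, smul_add, Finset.sum_add_distrib] at this
  simp [Fin.sum_univ_add, Pi.single_apply, -Finset.sum_neg_distrib] at this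
  zify
  rw [Fin.sum_univ_add, Finset.sum_comm (γ := Fin p)]
  simp only [Finset.sum_neg_distrib] at this
  linarith

end CramerHom

section Shear

variable {k : Type*} [CommRing k] {n p : ℕ}

/-- The exponent obtained by moving row `i₂` of an exponent `b` into row `i₁`. -/
noncomputable def mergeRows (i₁ i₂ : Fin p) (b : Fin n ×ₗ Fin p →₀ ℕ) : Fin n ×ₗ Fin p →₀ ℕ :=
  Finsupp.equivFunOnFinite.symm fun v =>
    if (ofLex v).2 = i₂ then 0 else
      b v + if (ofLex v).2 = i₁ then b (toLex ((ofLex v).1, i₂)) else 0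

/-- Row `i` of an exponent. -/
noncomputable def expRow (i : Fin p) (b : Fin n ×ₗ Fin p →₀ ℕ) : Fin n →₀ ℕ :=
  Finsupp.equivFunOnFinite.symm fun j => b (toLex (j, i))

lemma expRow_apply (i : Fin p) (b : Fin n ×ₗ Fin p →₀ ℕ) (j : Fin n) :
    expRow i b j = b (toLex (j, i)) := rfl

lemma mergeRows_apply (i₁ i₂ : Fin p) (b : Fin n ×ₗ Fin p →₀ ℕ) (j : Fin n) (i : Fin p) :
    mergeRows i₁ i₂ b (toLex (j, i)) = if i = i₂ then 0 else
      b (toLex (j, i)) + if i = i₁ then b (toLex (j, i₂)) else 0 := rfl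

variable (k) in
/-- The substitution `z_{i₂ j} ↦ y_j z_{i₁ j}`. -/
noncomputable def shearHom (i₁ i₂ : Fin p) :
    MvPolynomial (Fin n ×ₗ Fin p) k →+* MvPolynomial (Fin n ×ₗ Fin p) (MvPolynomial (Fin n) k) :=
  MvPolynomial.eval₂Hom (MvPolynomial.C.comp MvPolynomial.C) fun v =>
    if (ofLex v).2 = i₂ then
      MvPolynomial.X (toLex ((ofLex v).1, i₁)) * MvPolynomial.C (MvPolynomial.X (ofLex v).1)
    else MvPolynomial.X v

lemma shearHom_monomial {i₁ i₂ : Fin p} (hi : i₁ ≠ i₂) (b : Fin n ×ₗ Fin p →₀ ℕ) (c : k) :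
    shearHom k i₁ i₂ (MvPolynomial.monomial b c) =
      MvPolynomial.monomial (mergeRows i₁ i₂ b) (MvPolynomial.monomial (expRow i₂ b) c) := by
  have h1 : shearHom k i₁ i₂ (MvPolynomial.monomial b 1) =
      MvPolynomial.monomial (mergeRows i₁ i₂ b) (MvPolynomial.monomial (expRow i₂ b) 1) := by
    induction b using Finsupp.induction_linear with
    | zero =>
      have e1 : mergeRows i₁ i₂ (0 : Fin n ×ₗ Fin p →₀ ℕ) = 0 := by
        ext v; simp [mergeRows]
      have e2 : expRow i₂ (0 : Fin n ×ₗ Fin p →₀ ℕ) = 0 := by ext v; simp [expRow]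
      rw [e1, e2]
      exact map_one (shearHom k i₁ i₂)
    | add f g hf hg =>
      have e1 : mergeRows i₁ i₂ (f + g) = mergeRows i₁ i₂ f + mergeRows i₁ i₂ g := by
        ext v
        simp only [mergeRows, Finsupp.equivFunOnFinite_symm_apply_apply, Finsupp.add_apply]
        split_ifs <;> ring
      have e2 : expRow i₂ (f + g) = expRow i₂ f + expRow i₂ g := by ext v; simp [expRow]
      have e3 (x y : Fin n ×ₗ Fin p →₀ ℕ) : MvPolynomial.monomial (x + y) (1 : k) =
          MvPolynomial.monomial x 1 * MvPolynomial.monomial y 1 := by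
        simp [MvPolynomial.monomial_mul]
      rw [e3, map_mul, hf, hg, e1, e2]
      simp [MvPolynomial.monomial_mul]
    | single v m =>
      rw [← MvPolynomial.X_pow_eq_monomial, map_pow]
      obtain ⟨⟨j, i⟩, rfl⟩ := toLex.surjective v
      have key : shearHom k i₁ i₂ (MvPolynomial.X (toLex (j, i))) =
          if i = i₂ then
          MvPolynomial.X (toLex (j, i₁)) * MvPolynomial.C (MvPolynomial.X j)
          else MvPolynomial.X (toLex (j, i)) := by
        by_cases h : i = i₂ <;> simp [shearHom, h]
      rw [key]
      by_cases h : i = i₂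
      · subst h
        rw [if_pos rfl, mul_pow, ← map_pow, MvPolynomial.X_pow_eq_monomial,
          MvPolynomial.X_pow_eq_monomial, mul_comm, MvPolynomial.C_mul_monomial, mul_one]
        have e1 : mergeRows i₁ i (Finsupp.single (toLex (j, i)) m) =
            Finsupp.single (toLex (j, i₁)) m := by
          ext v
          obtain ⟨⟨j', i'⟩, rfl⟩ := toLex.surjective v
          rw [mergeRows_apply]
          simp only [Finsupp.single_apply, toLex_inj, Prod.mk.injEq]
          grind
        have e2 : expRow i (Finsupp.single (toLex (j, i)) m) = Finsupp.single j m := by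
          ext j'
          simp [expRow_apply, Finsupp.single_apply]
        rw [e1, e2]
      · rw [if_neg h, MvPolynomial.X_pow_eq_monomial]
        have e1 : mergeRows i₁ i₂ (Finsupp.single (toLex (j, i)) m) =
            Finsupp.single (toLex (j, i)) m := by
          ext v
          obtain ⟨⟨j', i'⟩, rfl⟩ := toLex.surjective v
          rw [mergeRows_apply]
          simp only [Finsupp.single_apply, toLex_inj, Prod.mk.injEq]
          grind
        have e2 : expRow i₂ (Finsupp.single (toLex (j, i)) m) = 0 := by
          ext j'
          simp [expRow_apply, h]
        rw [e1, e2]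
        rfl
  rw [← mul_one c, ← MvPolynomial.C_mul_monomial, map_mul, h1, ← MvPolynomial.C_mul_monomial,
    ← MvPolynomial.C_mul_monomial]
  congr 1
  simp [shearHom]

lemma coeff_coeff_shearHom {i₁ i₂ : Fin p} (hi : i₁ ≠ i₂) (G : MvPolynomial (Fin n ×ₗ Fin p) k)
    (u : Fin n ×ₗ Fin p →₀ ℕ) (r : Fin n →₀ ℕ) :
    ((shearHom k i₁ i₂ G).coeff u).coeff r =
      ∑ b ∈ G.support, if mergeRows i₁ i₂ b = u ∧ expRow i₂ b = r then G.coeff b else 0 := by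
  conv_lhs => rw [G.as_sum]
  rw [map_sum, MvPolynomial.coeff_sum, MvPolynomial.coeff_sum]
  refine Finset.sum_congr rfl fun b _ => ?_
  rw [shearHom_monomial hi, MvPolynomial.coeff_monomial]
  split_ifs with h1 h2 h2 <;> simp_all [MvPolynomial.coeff_monomial]

lemma eq_of_mergeRows_eq {i₁ i₂ : Fin p} {a b : Fin n ×ₗ Fin p →₀ ℕ} {j : Fin n}
    (h1 : mergeRows i₁ i₂ a = mergeRows i₁ i₂ b) (h2 : expRow i₂ a j = expRow i₂ b j)
    (i : Fin p) : a (toLex (j, i)) = b (toLex (j, i)) := by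
  have := DFunLike.congr_fun h1 (toLex (j, i))
  rw [mergeRows_apply, mergeRows_apply] at this
  rw [expRow_apply, expRow_apply] at h2
  split_ifs at this <;> grind

end Shear

section Ballot

variable {k : Type*} [CommRing k] {p q : ℕ}

theorem ballot_of_mem_support_cramerHom (f : MvPolynomial (Fin p × Fin q) k)
    {a : Fin (q + p) ×ₗ Fin p →₀ ℕ} (ha : a ∈ (cramerHom k p q f).support)
    (hmax : ∀ b ∈ (cramerHom k p q f).support, ∀ v, (∀ v' < v, b v' = a v') → b v ≤ a v)
    {i₁ i₂ : Fin p} (hi : i₁ < i₂) (j : Fin (q + p)) :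
    (∑ j', if j' ≤ j then a (toLex (j', i₂)) else 0) ≤
      ∑ j', if j' < j then a (toLex (j', i₁)) else 0 := by
  classical
  set G := cramerHom k p q f with hG
  set u := mergeRows i₁ i₂ a with hu
  set g := (shearHom k i₁ i₂ G).coeff u with hg
  have hsupp : ∀ r ∈ g.support, ∃ b ∈ G.support, mergeRows i₁ i₂ b = u ∧ expRow i₂ b = r := by
    intro r hr
    rw [MvPolynomial.mem_support_iff, hg, coeff_coeff_shearHom hi.ne] at hr
    obtain ⟨b, hb, hne⟩ := Finset.exists_ne_zero_of_sum_ne_zero hr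
    exact ⟨b, hb, by_contra fun h => hne (if_neg h)⟩
  have hr : expRow i₂ a ∈ g.support := by
    rw [MvPolynomial.mem_support_iff, hg, coeff_coeff_shearHom hi.ne, Finset.sum_eq_single a]
    · rw [if_pos ⟨rfl, rfl⟩]
      exact MvPolynomial.mem_support_iff.1 ha
    · intro b hb hba
      refine if_neg fun h => hba ?_
      ext v
      exact eq_of_mergeRows_eq h.1 (DFunLike.congr_fun h.2 _) (ofLex v).2
    · exact fun h => absurd ha h
  have hmerge : ∀ b : Fin (q + p) ×ₗ Fin p →₀ ℕ, mergeRows i₁ i₂ b = u → ∀ j,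
      b (toLex (j, i₁)) + b (toLex (j, i₂)) = a (toLex (j, i₁)) + a (toLex (j, i₂)) := by
    intro b hb j
    simpa [hu, mergeRows_apply, hi.ne] using DFunLike.congr_fun hb (toLex (j, i₁))
  have hinv : translate k (q + p) g = Polynomial.C g := by
    let T := (MvPolynomial.map (translate k (q + p)).toRingHom).comp
      (shearHom k (n := q + p) i₁ i₂)
    let S := (MvPolynomial.map Polynomial.C).comp (shearHom k (n := q + p) i₁ i₂)
    have := map_cramerHom_eq (B := MvPolynomial (Fin (q + p) ×ₗ Fin p)
      (Polynomial (MvPolynomial (Fin (q + p)) k))) (f := T) (g := S) ?_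
      (Matrix.transvection i₂ i₁ (MvPolynomial.C Polynomial.X))
      (Matrix.det_transvection_of_ne _ _ hi.ne' _) ?_ f
    · have h1 := congrArg (MvPolynomial.coeff u) this
      simpa [T, S, MvPolynomial.coeff_map] using h1
    · intro a
      simp [T, S, shearHom, translate, MvPolynomial.algebraMap_eq,
        IsScalarTower.algebraMap_apply k (MvPolynomial (Fin (q + p)) k)
        (Polynomial (MvPolynomial (Fin (q + p)) k))]
    · ext1 i j
      by_cases h : i = i₂
      · subst h
        rw [Matrix.transvection_mul_apply_same]
        simp [T, S, genericWide, shearHom, hi.ne, translate]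
        ring
      · rw [Matrix.transvection_mul_apply_of_ne _ _ _ _ h]
        simp [T, S, genericWide, shearHom, h]
  have := ballot_of_natDegree_translate_le g 0
    (fun j => a (toLex (j, i₁)) + a (toLex (j, i₂))) (expRow i₂ a)
    (by rw [hinv, Polynomial.natDegree_C])
    (fun r hr j => by
      obtain ⟨b, -, hb, rfl⟩ := hsupp r hr
      rw [← hmerge b hb]
      exact Nat.le_add_left _ _)
    hr
    (fun r hr j hj => by
      obtain ⟨b, hbs, hb, rfl⟩ := hsupp r hr
      have h1 := hmax b hbs (toLex (j, i₁)) fun v hv => by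
        obtain ⟨⟨j', i'⟩, rfl⟩ := toLex.surjective v
        rcases Prod.Lex.toLex_lt_toLex.1 hv with h | ⟨h, h'⟩
        · exact eq_of_mergeRows_eq hb (hj j' h) i'
        · simp only at h h'
          subst h
          have := DFunLike.congr_fun hb (toLex (j', i'))
          rw [hu, mergeRows_apply, mergeRows_apply] at this
          simpa [(h'.trans hi).ne, h'.ne] using this
      have h2 := hmerge b hb j
      rw [expRow_apply, expRow_apply]
      omega)
    j
  have hsum : (∑ j', if j' < j then a (toLex (j', i₁)) + a (toLex (j', i₂)) else 0) =
      (∑ j', if j' < j then a (toLex (j', i₁)) else 0) +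
      ∑ j', if j' < j then a (toLex (j', i₂)) else 0 := by
    rw [← Finset.sum_add_distrib]
    refine Finset.sum_congr rfl fun x _ => ?_
    split_ifs <;> rfl
  simp only [expRow_apply, hsum] at this
  omega

end Ballot

section Peel

variable {n p : ℕ}

/-- The exponent of `∏ i, z_{i, c i}`. -/
noncomputable def colExp (c : Fin p → Fin n) : Fin n ×ₗ Fin p →₀ ℕ :=
  ∑ i, Finsupp.single (toLex (c i, i)) 1

lemma colExp_apply (c : Fin p → Fin n) (j : Fin n) (i : Fin p) :
    colExp c (toLex (j, i)) = if c i = j then 1 else 0 := by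
  rw [colExp, Finsupp.finsetSum_apply, Finset.sum_eq_single i]
  · simp [Finsupp.single_apply]
  · intro l _ hl
    simp [hl]
  · simp

/-- An exponent with equal row sums satisfying the ballot conditions is a sum of exponents of
strictly increasing column choices. -/
theorem exists_list_colExp (d : ℕ) (a : Fin n ×ₗ Fin p →₀ ℕ)
    (hrow : ∀ i, ∑ j, a (toLex (j, i)) = d)
    (hballot : ∀ i₁ i₂ : Fin p, i₁ < i₂ → ∀ j, (∑ j', if j' ≤ j then a (toLex (j', i₂)) else 0) ≤
      ∑ j', if j' < j then a (toLex (j', i₁)) else 0) :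
    ∃ L : List (Fin p → Fin n), L.length = d ∧ (∀ c ∈ L, StrictMono c) ∧
      (L.map colExp).sum = a := by
  induction d generalizing a with
  | zero =>
    refine ⟨[], rfl, by simp, ?_⟩
    ext v
    obtain ⟨⟨j, i⟩, rfl⟩ := toLex.surjective v
    have := Finset.sum_eq_zero_iff.1 (hrow i) j (Finset.mem_univ _)
    simp [this]
  | succ d ih =>
    have hex : ∀ i, ∃ j, 0 < a (toLex (j, i)) ∧ ∀ j' < j, a (toLex (j', i)) = 0 := by
      intro i
      have : ∃ j, 0 < a (toLex (j, i)) := by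
        by_contra! h
        have := hrow i
        simp [fun j => Nat.le_zero.1 (h j)] at this
      obtain ⟨j, hj, hmin⟩ := WellFounded.has_min (wellFounded_lt (α := Fin n))
        {j | 0 < a (toLex (j, i))} this
      exact ⟨j, hj, fun j' h => Nat.eq_zero_of_not_pos fun h' => hmin j' h' h⟩
    choose c hc hmin using hex
    have hle : colExp c ≤ a := by
      intro v
      obtain ⟨⟨j, i⟩, rfl⟩ := toLex.surjective v
      rw [colExp_apply]
      split_ifs with h
      · subst h
        exact hc i
      · exact Nat.zero_le _
    obtain ⟨a', rfl⟩ := exists_add_of_le hle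
    have hmono : StrictMono c := by
      intro i₁ i₂ hi
      by_contra! h
      have hb := hballot i₁ i₂ hi (c i₂)
      have h0 : (∑ j', if j' < c i₂ then (colExp c + a') (toLex (j', i₁)) else 0) = 0 :=
        Finset.sum_eq_zero fun j' _ => by
          split_ifs with h'
          · exact hmin i₁ j' (h'.trans_le h)
          · rfl
      rw [h0, Nat.le_zero, Finset.sum_eq_zero_iff] at hb
      have := hb (c i₂) (Finset.mem_univ _)
      rw [if_pos le_rfl] at this
      exact (hc i₂).ne' this
    have hle' (i : Fin p) (j : Fin n) :
        (∑ j', if j' ≤ j then colExp c (toLex (j', i)) else 0) = if c i ≤ j then 1 else 0 := by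
      rw [Finset.sum_eq_single (c i)]
      · simp [colExp_apply]
      · intro b _ hb
        simp [colExp_apply, hb.symm]
      · simp
    have hlt' (i : Fin p) (j : Fin n) :
        (∑ j', if j' < j then colExp c (toLex (j', i)) else 0) = if c i < j then 1 else 0 := by
      rw [Finset.sum_eq_single (c i)]
      · simp [colExp_apply]
      · intro b _ hb
        simp [colExp_apply, hb.symm]
      · simp
    have hadd (P : Fin n → Prop) [DecidablePred P] (i : Fin p) :
        (∑ j', if P j' then (colExp c + a') (toLex (j', i)) else 0) =
        (∑ j', if P j' then colExp c (toLex (j', i)) else 0) +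
          ∑ j', if P j' then a' (toLex (j', i)) else 0 := by
      rw [← Finset.sum_add_distrib]
      refine Finset.sum_congr rfl fun x _ => ?_
      split_ifs <;> simp
    obtain ⟨L, hL, hLm, hLs⟩ := ih a' (fun i => by
        have := hrow i
        simp only [Finsupp.add_apply, colExp_apply, Finset.sum_add_distrib, Finset.sum_ite_eq,
          Finset.mem_univ, if_true] at this
        omega)
      (fun i₁ i₂ hi j => by
        have := hballot i₁ i₂ hi j
        rw [hadd, hadd, hle', hlt'] at this
        by_cases h : c i₂ ≤ j
        · rw [if_pos h, if_pos ((hmono hi).trans_le h)] at this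
          omega
        · have h0 : (∑ j', if j' ≤ j then a' (toLex (j', i₂)) else 0) = 0 :=
            Finset.sum_eq_zero fun j' _ => by
              split_ifs with h'
              · have := hmin i₂ j' (h'.trans_lt (not_le.1 h))
                rw [Finsupp.add_apply] at this
                omega
              · rfl
          rw [h0]
          exact Nat.zero_le _)
    exact ⟨c :: L, by simp [hL], by simpa using ⟨hmono, hLm⟩, by simp [hLs]⟩

end Peel

section Lead

variable {k : Type*} [CommRing k] {p q : ℕ}

lemma maxMinor_genericWide (c : Fin p → Fin (q + p)) :
    maxMinor (genericWide k p q) c = ∑ τ : Equiv.Perm (Fin p),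
      MvPolynomial.monomial (∑ l, Finsupp.single (toLex (c l, τ l)) 1)
        (((Equiv.Perm.sign τ : ℤ) : k)) := by
  rw [maxMinor, Matrix.det_apply']
  refine Finset.sum_congr rfl fun τ _ => ?_
  rw [← mul_one ((Equiv.Perm.sign τ : ℤ) : k), ← MvPolynomial.C_mul_monomial, map_intCast,
    MvPolynomial.monomial_sum_one]
  rfl

lemma permExp_lt {c : Fin p → Fin (q + p)} (hc : StrictMono c) {τ : Equiv.Perm (Fin p)}
    (hτ : τ ≠ 1) : MonomialOrder.lex.toSyn (∑ l, Finsupp.single (toLex (c l, τ l)) 1) <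
      MonomialOrder.lex.toSyn (colExp c) := by
  have hex : ∃ l, τ l ≠ l ∧ ∀ l' < l, τ l' = l' := by
    have : ∃ l, τ l ≠ l := by
      by_contra! h
      exact hτ (Equiv.ext h)
    obtain ⟨l, hl, hmin⟩ := WellFounded.has_min (wellFounded_lt (α := Fin p)) {l | τ l ≠ l} this
    exact ⟨l, hl, fun l' h => by_contra fun h' => hmin l' h' h⟩
  obtain ⟨l, hl, hfix⟩ := hex
  have hlt : l < τ l := by
    refine lt_of_le_of_ne ?_ hl.symm
    by_contra! h
    exact hl (τ.injective (hfix _ h))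
  have happ (l' : Fin p) (i : Fin p) :
      (∑ l, Finsupp.single (toLex (c l, τ l)) 1 : Fin (q + p) ×ₗ Fin p →₀ ℕ) (toLex (c l', i)) =
        if τ l' = i then 1 else 0 := by
    rw [Finsupp.finsetSum_apply, Finset.sum_eq_single l']
    · simp [Finsupp.single_apply]
    · intro l'' _ h
      simp [hc.injective.ne h]
    · simp
  rw [MonomialOrder.lex_lt_iff, Finsupp.Lex.lt_iff]
  refine ⟨toLex (c l, l), ?_, ?_⟩
  · intro v hv
    obtain ⟨⟨j, i⟩, rfl⟩ := toLex.surjective v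
    change (∑ l, Finsupp.single (toLex (c l, τ l)) 1 : Fin (q + p) ×ₗ Fin p →₀ ℕ) _ =
      colExp c _
    rw [colExp_apply]
    by_cases hj : ∃ l', c l' = j
    · obtain ⟨l', rfl⟩ := hj
      rw [happ]
      rcases Prod.Lex.toLex_lt_toLex.1 hv with h | ⟨h, h'⟩
      · rw [hfix l' (hc.lt_iff_lt.1 h)]
        simp [hc.injective.eq_iff, eq_comm]
      · obtain rfl := hc.injective h
        simp only at h'
        rw [if_neg (h'.trans hlt).ne', if_neg (hc.injective.ne h'.ne)]
    · push Not at hj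
      rw [if_neg (hj i), Finsupp.finsetSum_apply]
      refine Finset.sum_eq_zero fun l' _ => ?_
      simp [hj l']
  · change (∑ l, Finsupp.single (toLex (c l, τ l)) 1 : Fin (q + p) ×ₗ Fin p →₀ ℕ) _ <
      colExp c _
    rw [happ, if_neg hl, colExp_apply, if_pos rfl]
    exact Nat.one_pos

lemma degree_monic_maxMinor [Nontrivial k] {c : Fin p → Fin (q + p)} (hc : StrictMono c) :
    MonomialOrder.lex.degree (maxMinor (genericWide k p q) c) = colExp c ∧
      MonomialOrder.lex.Monic (maxMinor (genericWide k p q) c) := by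
  have hcoeff : (maxMinor (genericWide k p q) c).coeff (colExp c) = 1 := by
    rw [maxMinor_genericWide, MvPolynomial.coeff_sum, Finset.sum_eq_single 1]
    · simp [colExp]
    · intro τ _ hτ
      rw [MvPolynomial.coeff_monomial, if_neg]
      intro h
      exact (permExp_lt hc hτ).ne (congrArg _ h)
    · simp
  have hdeg : MonomialOrder.lex.degree (maxMinor (genericWide k p q) c) = colExp c := by
    apply MonomialOrder.lex.toSyn.injective
    apply le_antisymm
    · rw [maxMinor_genericWide]
      refine MonomialOrder.lex.degree_sum_le.trans (Finset.sup_le fun τ _ => ?_)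
      refine (MonomialOrder.lex.degree_monomial_le _).trans ?_
      by_cases h : τ = 1
      · subst h
        exact le_rfl
      · exact (permExp_lt hc h).le
    · apply MonomialOrder.lex.le_degree
      rw [MvPolynomial.mem_support_iff, hcoeff]
      exact one_ne_zero
  refine ⟨hdeg, ?_⟩
  rw [MonomialOrder.Monic, MonomialOrder.leadingCoeff, hdeg, hcoeff]

lemma degree_monic_list_prod [IsDomain k] (L : List (Fin p → Fin (q + p)))
    (hL : ∀ c ∈ L, StrictMono c) :
    MonomialOrder.lex.degree (L.map (maxMinor (genericWide k p q))).prod = (L.map colExp).sum ∧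
      MonomialOrder.lex.Monic (L.map (maxMinor (genericWide k p q))).prod := by
  induction L with
  | nil => simp [MonomialOrder.monic_one]
  | cons c L ih =>
    obtain ⟨h1, h2⟩ := degree_monic_maxMinor (k := k) (hL c (by simp))
    obtain ⟨h3, h4⟩ := ih fun c' h => hL c' (by simp [h])
    simp only [List.map_cons, List.prod_cons, List.sum_cons]
    exact ⟨by rw [MonomialOrder.lex.degree_mul h2.ne_zero h4.ne_zero, h1, h3], h2.mul h4⟩

end Lead

section LeftCount

variable {p q : ℕ}

/-- The number of chosen columns among the first `q` ones. -/
def leftCount (c : Fin p → Fin (q + p)) : ℕ :=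
  ∑ l, Fin.append (fun _ : Fin q => 1) (fun _ : Fin p => 0) (c l)

lemma weight_colExp (w : Fin (q + p) ×ₗ Fin p → ℕ) (c : Fin p → Fin (q + p)) :
    Finsupp.weight w (colExp c) = ∑ l, w (toLex (c l, l)) := by
  rw [colExp, map_sum]
  exact Finset.sum_congr rfl fun l _ => by simp [Finsupp.weight_single]

variable {k : Type*} [CommRing k]

lemma columnScale_mul_pow (Z : Matrix (Fin p) (Fin (q + p)) k) (j : Fin (q + p)) :
    columnScale Z j * (rightBlock Z).det ^ Fin.append (fun _ : Fin q => 1) (fun _ : Fin p => 0) j =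
      (rightBlock Z).det := by
  refine Fin.addCases (fun j => ?_) (fun j => ?_) j <;> simp [columnScale]

lemma pow_mul_list_prod_maxMinor (L : List (Fin p → Fin (q + p))) :
    (rightBlock (genericWide k p q)).det ^ ((p - 1) * L.length + (L.map leftCount).sum) *
        (L.map (maxMinor (genericWide k p q))).prod =
      (rightBlock (genericWide k p q)).det ^ (p * L.length) *
        cramerHom k p q (L.map (maxMinor (augment (genericMatrix k p q)))).prod := by
  induction L with
  | nil => simp
  | cons c L ih =>
    have h1 : (∏ l, columnScale (genericWide k p q) (c l)) *
        (rightBlock (genericWide k p q)).det ^ leftCount c =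
        (rightBlock (genericWide k p q)).det ^ p := by
      rw [leftCount, ← Finset.prod_pow_eq_pow_sum, ← Finset.prod_mul_distrib]
      simp [columnScale_mul_pow]
    have h2 := det_rightBlock_pow_mul_maxMinor (genericWide k p q) c
    rw [← cramerHom_maxMinor] at h2
    simp only [List.length_cons, List.map_cons, List.sum_cons, List.prod_cons, map_mul]
    set D := (rightBlock (genericWide k p q)).det
    calc _ = (D ^ (p - 1) * maxMinor (genericWide k p q) c) * D ^ leftCount c *
          (D ^ ((p - 1) * L.length + (L.map leftCount).sum) *
            (L.map (maxMinor (genericWide k p q))).prod) := by ring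
      _ = _ := by
        rw [ih, h2, mul_assoc (cramerHom k p q _), h1]
        ring

lemma det_rightBlock_genericWide_ne_zero [Nontrivial k] :
    (rightBlock (genericWide k p q)).det ≠ 0 :=
  (degree_monic_maxMinor (k := k) (c := Fin.natAdd q) (Fin.strictMono_natAdd q)).2.ne_zero

lemma cramerHom_list_prod [IsDomain k] (hp : 1 ≤ p) (L : List (Fin p → Fin (q + p)))
    (hL : (L.map leftCount).sum = L.length) :
    cramerHom k p q (L.map (maxMinor (augment (genericMatrix k p q)))).prod =
      (L.map (maxMinor (genericWide k p q))).prod := by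
  have h := pow_mul_list_prod_maxMinor (k := k) L
  have : (p - 1) * L.length + L.length = p * L.length := by
    obtain ⟨p, rfl⟩ := Nat.exists_eq_add_of_le' hp
    rw [Nat.add_sub_cancel]
    ring
  rw [hL, this] at h
  exact (mul_left_cancel₀ (pow_ne_zero _ det_rightBlock_genericWide_ne_zero) h).symm

/-- The leading exponent of `cramerHom f` is that of a product of maximal minors. -/
theorem exists_list_of_cramerHom_ne_zero (f : MvPolynomial (Fin p × Fin q) k)
    (hf : cramerHom k p q f ≠ 0) :
    ∃ L : List (Fin p → Fin (q + p)), (∀ c ∈ L, StrictMono c) ∧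
      (L.map colExp).sum = MonomialOrder.lex.degree (cramerHom k p q f) ∧
      (L.map leftCount).sum = L.length := by
  set a := MonomialOrder.lex.degree (cramerHom k p q f) with ha
  have hmem : a ∈ (cramerHom k p q f).support := MonomialOrder.lex.degree_mem_support hf
  have hmax : ∀ b ∈ (cramerHom k p q f).support, ∀ v, (∀ v' < v, b v' = a v') → b v ≤ a v := by
    intro b hb v hv
    by_contra! h
    refine (MonomialOrder.lex.le_degree hb).not_gt ?_
    rw [MonomialOrder.lex_lt_iff, Finsupp.Lex.lt_iff]
    exact ⟨v, fun v' h' => (hv v' h').symm, h⟩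
  have hrow := sum_row_eq_of_mem_support_cramerHom f hmem
  obtain ⟨L, hLd, hLm, hLs⟩ := exists_list_colExp _ a hrow
    fun i₁ i₂ hi j => ballot_of_mem_support_cramerHom f hmem hmax hi j
  refine ⟨L, hLm, hLs, ?_⟩
  let w : Fin (q + p) ×ₗ Fin p → ℕ := fun v =>
    Fin.append (fun _ : Fin q => 1) (fun _ : Fin p => 0) (ofLex v).1
  have h1 : (fun c => Finsupp.weight w (colExp c)) = leftCount (p := p) (q := q) := by
    ext c
    rw [weight_colExp]
    rfl
  rw [hLd, ← h1, ← Function.comp_def, ← List.map_map, ← map_list_sum, hLs, Finsupp.weight_apply,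
    Finsupp.sum_fintype _ _ (by simp), ← (toLex (α := Fin (q + p) × Fin p)).sum_comp,
    Fintype.sum_prod_type, Finset.sum_comm]
  simp [w, Fin.sum_univ_add]

end LeftCount

section Weight

variable {k : Type*} [CommRing k] {p q : ℕ}

/-- The indicator of the variables in the first `q` columns and in rows `≥ s`. -/
def lowerLeft (p q s : ℕ) (v : Fin (q + p) ×ₗ Fin p) : ℕ :=
  if s ≤ ((ofLex v).2 : ℕ) then Fin.append (fun _ : Fin q => 1) (fun _ : Fin p => 0) (ofLex v).1
  else 0

variable (k) in
/-- The substitution `z_v ↦ λ ^ (w v) z_v`. -/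
noncomputable def weightHom {σ : Type*} (w : σ → ℕ) :
    MvPolynomial σ k →+* Polynomial (MvPolynomial σ k) :=
  MvPolynomial.eval₂Hom (Polynomial.C.comp MvPolynomial.C) fun v =>
    Polynomial.X ^ w v * Polynomial.C (MvPolynomial.X v)

lemma weightHom_monomial {σ : Type*} (w : σ → ℕ) (b : σ →₀ ℕ) (c : k) :
    weightHom k w (MvPolynomial.monomial b c) =
      Polynomial.X ^ Finsupp.weight w b * Polynomial.C (MvPolynomial.monomial b c) := by
  rw [weightHom, MvPolynomial.coe_eval₂Hom, MvPolynomial.eval₂_monomial, MvPolynomial.monomial_eq,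
    Finsupp.weight_apply]
  simp only [mul_pow, Finsupp.prod, Finset.prod_mul_distrib, Finsupp.sum, map_mul, map_prod,
    map_pow, ← pow_mul, Finset.prod_pow_eq_pow_sum, smul_eq_mul, RingHom.comp_apply]
  simp only [mul_comm]
  ring

lemma le_weight_of_pow_dvd {σ : Type*} (w : σ → ℕ) (G : MvPolynomial σ k) (m : ℕ)
    (h : Polynomial.X ^ m ∣ weightHom k w G) {b : σ →₀ ℕ} (hb : b ∈ G.support) :
    m ≤ Finsupp.weight w b := by
  classical
  by_contra! hlt
  have h0 := congrArg (MvPolynomial.coeff b) (Polynomial.X_pow_dvd_iff.1 h _ hlt)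
  rw [G.as_sum, map_sum, Polynomial.finsetSum_coeff, MvPolynomial.coeff_sum,
    Finset.sum_eq_single b] at h0
  · rw [weightHom_monomial, Polynomial.coeff_X_pow_mul', if_pos le_rfl, Nat.sub_self,
      Polynomial.coeff_C_zero, MvPolynomial.coeff_monomial, if_pos rfl] at h0
    exact MvPolynomial.mem_support_iff.1 hb h0
  · intro b' _ hb'
    rw [weightHom_monomial, Polynomial.coeff_X_pow_mul', Polynomial.coeff_C]
    split_ifs <;> simp [MvPolynomial.coeff_monomial, hb']
  · exact fun h => absurd hb h

/-- The number of chosen columns among the first `q` ones, minus `s`. -/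
def excess (s : ℕ) (c : Fin p → Fin (q + p)) : ℕ := leftCount c - s

lemma card_lt_le (s : ℕ) : (∑ l : Fin p, if (l : ℕ) < s then 1 else 0) ≤ s := by
  rw [Finset.sum_boole, Nat.cast_id]
  calc _ ≤ (Finset.range s).card := Finset.card_le_card_of_injOn (fun l : Fin p => (l : ℕ))
        (fun l hl => by simpa using hl) (fun _ _ _ _ h => Fin.ext h)
    _ = s := Finset.card_range s

lemma excess_le_sum_lowerLeft (s : ℕ) (c : Fin p → Fin (q + p)) (τ : Equiv.Perm (Fin p)) :
    excess s c ≤ ∑ l, lowerLeft p q s (toLex (c l, τ l)) := by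
  have h1 : leftCount c ≤ (∑ l, lowerLeft p q s (toLex (c l, τ l))) +
      ∑ l, if ((τ l : Fin p) : ℕ) < s then 1 else 0 := by
    rw [leftCount, ← Finset.sum_add_distrib]
    refine Finset.sum_le_sum fun l _ => ?_
    simp only [lowerLeft, ofLex_toLex]
    refine Fin.addCases (fun j => ?_) (fun j => ?_) (c l)
    · simp only [Fin.append_left]
      split_ifs <;> omega
    · simp
  have h2 := Equiv.sum_comp τ fun l : Fin p => if (l : ℕ) < s then 1 else 0
  have h3 := card_lt_le (p := p) s
  rw [excess]
  omega

lemma sum_lowerLeft_le_excess {s : ℕ} (hs : s ≤ p) {c : Fin p → Fin (q + p)} (hc : StrictMono c) :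
    ∑ l, lowerLeft p q s (toLex (c l, l)) ≤ excess s c := by
  have happ (j : Fin (q + p)) :
      Fin.append (fun _ : Fin q => 1) (fun _ : Fin p => 0) j = if (j : ℕ) < q then 1 else 0 := by
    refine Fin.addCases (fun j => ?_) (fun j => ?_) j <;> simp
  by_cases h : ∃ l : Fin p, s ≤ (l : ℕ) ∧ (c l : ℕ) < q
  · obtain ⟨l₀, hl₀, hl₀'⟩ := h
    have h1 : (∑ l, lowerLeft p q s (toLex (c l, l))) +
        (∑ l : Fin p, if (l : ℕ) < s then 1 else 0) ≤ leftCount c := by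
      rw [leftCount, ← Finset.sum_add_distrib]
      refine Finset.sum_le_sum fun l _ => ?_
      simp only [lowerLeft, ofLex_toLex, happ]
      have : (l : ℕ) < s → (c l : ℕ) < q := fun h =>
        lt_trans (hc (Fin.lt_def.2 (h.trans_le hl₀))) hl₀'
      split_ifs <;> omega
    have h2 : (∑ l : Fin p, if (l : ℕ) < s then 1 else 0) = s := by
      rw [Finset.sum_boole, Nat.cast_id, Fin.card_filter_val_lt, min_eq_right hs]
    rw [excess]
    omega
  · push Not at h
    refine (Finset.sum_eq_zero fun l _ => ?_).trans_le (Nat.zero_le _)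
    simp only [lowerLeft, ofLex_toLex, happ]
    have := h l
    split_ifs <;> omega

lemma pow_excess_dvd_weightHom_maxMinor (s : ℕ) (c : Fin p → Fin (q + p)) :
    Polynomial.X ^ excess s c ∣ weightHom k (lowerLeft p q s) (maxMinor (genericWide k p q) c) := by
  rw [maxMinor_genericWide, map_sum]
  refine Finset.dvd_sum fun τ _ => ?_
  rw [weightHom_monomial]
  refine Dvd.dvd.mul_right (pow_dvd_pow _ ?_) _
  rw [map_sum]
  simpa [Finsupp.weight_single] using excess_le_sum_lowerLeft s c τ

lemma pow_excess_dvd_list_prod (s : ℕ) (L : List (Fin p → Fin (q + p))) :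
    Polynomial.X ^ (L.map (excess s)).sum ∣
      weightHom k (lowerLeft p q s) (L.map (maxMinor (genericWide k p q))).prod := by
  induction L with
  | nil => simp
  | cons c L ih =>
    simp only [List.map_cons, List.sum_cons, List.prod_cons, map_mul, pow_add]
    exact mul_dvd_mul (pow_excess_dvd_weightHom_maxMinor s c) ih

end Weight

section Descent

variable {k : Type*} [Field k] {p q : ℕ}

variable (k) in
/-- The valuation ideals attached to the `λ`-order of `cramerHom f`. -/
noncomputable def orderIdeal (p q s m : ℕ) : Ideal (MvPolynomial (Fin p × Fin q) k) :=
  Ideal.comap ((weightHom k (lowerLeft p q s)).comp (cramerHom k p q).toRingHom)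
    (Ideal.span {Polynomial.X ^ m})

lemma mem_orderIdeal {s m : ℕ} {f : MvPolynomial (Fin p × Fin q) k} :
    f ∈ orderIdeal k p q s m ↔
      Polynomial.X ^ m ∣ weightHom k (lowerLeft p q s) (cramerHom k p q f) := by
  rw [orderIdeal, Ideal.mem_comap, Ideal.mem_span_singleton]
  rfl

theorem orderIdeal_le {s m : ℕ} (hp : 1 ≤ p) (hs : s ≤ p)
    (K : Ideal (MvPolynomial (Fin p × Fin q) k))
    (hK : ∀ L : List (Fin p → Fin (q + p)), (∀ c ∈ L, StrictMono c) →
      m ≤ (L.map (excess s)).sum →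
        (L.map (maxMinor (augment (genericMatrix k p q)))).prod ∈ K) :
    orderIdeal k p q s m ≤ K := by
  intro f hf
  induction hx : MonomialOrder.lex.toSyn (MonomialOrder.lex.degree (cramerHom k p q f)) using
    WellFoundedLT.induction generalizing f with
  | ind x ih =>
  subst hx
  by_cases hf0 : cramerHom k p q f = 0
  · rw [cramerHom_injective (hf0.trans (map_zero _).symm)]
    exact K.zero_mem
  obtain ⟨L, hLm, hLs, hLc⟩ := exists_list_of_cramerHom_ne_zero f hf0
  set G := cramerHom k p q f with hG
  set a := MonomialOrder.lex.degree G with ha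
  set T := (L.map (maxMinor (augment (genericMatrix k p q)))).prod with hT
  have hΨT : cramerHom k p q T = _ := cramerHom_list_prod hp L hLc
  obtain ⟨hdeg, hmon⟩ := degree_monic_list_prod (k := k) L hLm
  rw [← hΨT] at hdeg hmon
  have hm : m ≤ (L.map (excess s)).sum := by
    have h1 := le_weight_of_pow_dvd _ G m (mem_orderIdeal.1 hf)
      (MonomialOrder.lex.degree_mem_support hf0)
    rw [← ha, ← hLs, map_list_sum, List.map_map] at h1
    refine h1.trans (List.sum_le_sum fun c hc => ?_)
    rw [Function.comp_apply, weight_colExp]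
    exact sum_lowerLeft_le_excess hs (hLm c hc)
  have hTK : T ∈ K := hK L hLm hm
  have hTV : T ∈ orderIdeal k p q s m := by
    rw [mem_orderIdeal, hΨT]
    exact (pow_dvd_pow _ hm).trans (pow_excess_dvd_list_prod s L)
  set f' := f - MvPolynomial.C (G.coeff a) * T with hf'
  have hfK : f' ∈ K → f ∈ K := fun h => by
    have := K.add_mem h (K.mul_mem_left (MvPolynomial.C (G.coeff a)) hTK)
    rwa [hf', sub_add_cancel] at this
  apply hfK
  have hΨf' : cramerHom k p q f' = G - MvPolynomial.C (G.coeff a) * cramerHom k p q T := by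
    rw [hf', map_sub, map_mul, ← hG]
    simp [cramerHom, MvPolynomial.algebraMap_eq]
  have hcoeff : (cramerHom k p q f').coeff a = 0 := by
    rw [hΨf', MvPolynomial.coeff_sub, MvPolynomial.coeff_C_mul]
    have := hmon.coeff_degree
    rw [hdeg, hLs] at this
    rw [this, mul_one, sub_self]
  by_cases h0 : cramerHom k p q f' = 0
  · rw [cramerHom_injective (h0.trans (map_zero _).symm)]
    exact K.zero_mem
  refine ih _ (lt_of_le_of_ne ?_ fun h => ?_)
    (Ideal.sub_mem _ hf (Ideal.mul_mem_left _ _ hTV)) rfl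
  · rw [hΨf']
    refine MonomialOrder.lex.degree_sub_le.trans (sup_le le_rfl ?_)
    rw [MvPolynomial.C_mul']
    exact (MonomialOrder.lex.degree_smul_le).trans_eq (by rw [hdeg, hLs])
  · have := MonomialOrder.lex.toSyn.injective h
    rw [← this] at hcoeff
    exact MonomialOrder.lex.coeff_degree_ne_zero_iff.2 h0 hcoeff

end Descent

section Minors

variable {A : Type*} [CommRing A] {p q t : ℕ}

/-- A square matrix with `t` columns taken from `M`, its rows possibly repeated, has its
determinant in every ideal containing the `t`-minors of `M`. -/
lemma det_mem_of_minors_mem {J : Ideal A} {M : Matrix (Fin p) (Fin q) A}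
    (hJ : ∀ r c, (M.submatrix r c : Matrix (Fin t) (Fin t) A).det ∈ J) {n : ℕ}
    (N : Matrix (Fin n) (Fin n) A) {e : Fin t → Fin n} (he : Function.Injective e)
    (ρ : Fin n → Fin p) (γ : Fin t → Fin q) (h : ∀ i b, N i (e b) = M (ρ i) (γ b)) :
    N.det ∈ J := by
  induction n with
  | zero =>
    have hb : Function.Bijective e := ⟨he, fun x => x.elim0⟩
    rw [← Matrix.det_submatrix_equiv_self (Equiv.ofBijective e hb) N]
    convert hJ (ρ ∘ e) γ using 2
    ext a b
    exact h _ _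
  | succ n ih =>
    by_cases hs : Function.Surjective e
    · rw [← Matrix.det_submatrix_equiv_self (Equiv.ofBijective e ⟨he, hs⟩) N]
      convert hJ (ρ ∘ e) γ using 2
      ext a b
      exact h _ _
    · simp only [Function.Surjective, not_forall, not_exists] at hs
      obtain ⟨j, hj⟩ := hs
      choose e' he' using fun b => Fin.exists_succAbove_eq (hj b)
      rw [Matrix.det_succ_column N j]
      refine J.sum_mem fun i _ => J.mul_mem_left _ (ih _ (e := e') (fun a b hab => he ?_)
        (ρ ∘ i.succAbove) fun l b => ?_)
      · rw [← he', hab, he']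
      · simp [he', h]

/-- The `t`-minors of `M₁ * M₂` vanish if less than `t` rows of `M₂` are nonzero. -/
lemma det_mul_submatrix_eq_zero {s : ℕ} (hs : s + 1 ≤ p) (M₁ : Matrix (Fin p) (Fin p) A)
    (M₂ : Matrix (Fin p) (Fin q) A) (h : ∀ (i : Fin p) j, s ≤ (i : ℕ) → M₂ i j = 0)
    (r : Fin (s + 1) → Fin p) (c : Fin (s + 1) → Fin q) :
    ((M₁ * M₂).submatrix r c).det = 0 := by
  have : (M₁ * M₂).submatrix r c =
      M₁.submatrix r (Fin.castLE hs) * M₂.submatrix (Fin.castLE hs) c := by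
    ext a b
    simp only [Matrix.submatrix_apply, Matrix.mul_apply]
    refine (Fintype.sum_of_injective (Fin.castLE hs) (Fin.castLE_injective hs) _ _
      (fun i hi => ?_) fun i => rfl).symm
    rw [h, mul_zero]
    by_contra! hlt
    exact hi ⟨⟨i, by omega⟩, rfl⟩
  rw [this, Matrix.det_mul, Matrix.det_eq_zero_of_row_eq_zero (A := M₂.submatrix _ c) (Fin.last s)
    fun b => h _ _ (by simp), mul_zero]

/-- If the columns of `W` outside `T` vanish off the diagonal, and the entries of `W` in `T × T`
lie in `J`, then its determinant lies in the power `J ^ #T`. -/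
lemma det_mem_pow_card {n : Type*} [Fintype n] [DecidableEq n] {J : Ideal A} (W : Matrix n n A)
    (T : Finset n) (h0 : ∀ l' l, l ∉ T → l' ≠ l → W l' l = 0)
    (hJ : ∀ l' ∈ T, ∀ l ∈ T, W l' l ∈ J) : W.det ∈ J ^ T.card := by
  rw [Matrix.det_apply']
  refine Ideal.sum_mem _ fun σ _ => Ideal.mul_mem_left _ _ ?_
  by_cases hσ : ∀ l, l ∉ T → σ l = l
  · rw [← Finset.prod_mul_prod_compl T, ← Finset.prod_const]
    refine Ideal.mul_mem_right _ _ (Ideal.prod_mem_prod fun l hl => hJ _ ?_ _ hl)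
    by_contra hl'
    exact hl' (by rwa [σ.injective (hσ _ hl')])
  · push Not at hσ
    obtain ⟨l, hl, hne⟩ := hσ
    have : ∏ i, W (σ i) i = 0 := Finset.prod_eq_zero (Finset.mem_univ l) (h0 _ _ hl hne)
    exact this ▸ zero_mem _

end Minors

section SymbolicPower

variable {R : Type*} [CommRing R] {I : Ideal R}

lemma mem_symbolicPower [IsNoetherianRing R] [hI : I.IsPrime] {n : ℕ} {f : R} :
    f ∈ symbolicPower I n ↔ ∃ u, u ∉ I ∧ u * f ∈ I ^ n := by
  change (∀ P ∈ associatedPrimes R (R ⧸ I), ∃ s, s ∉ P ∧ s * f ∈ I ^ n) ↔ _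
  rw [associatedPrimes.eq_singleton_of_isPrimary hI.isPrimary, hI.radical]
  simp

variable [IsNoetherianRing R] [I.IsPrime]

lemma symbolicPower_antitone : Antitone (symbolicPower I) := fun m n hmn f hf => by
  obtain ⟨u, hu, huf⟩ := mem_symbolicPower.1 hf
  exact mem_symbolicPower.2 ⟨u, hu, Ideal.pow_le_pow_right hmn huf⟩

lemma mul_mem_symbolicPower_add {m n : ℕ} {f g : R} (hf : f ∈ symbolicPower I m)
    (hg : g ∈ symbolicPower I n) : f * g ∈ symbolicPower I (m + n) := by
  obtain ⟨u, hu, huf⟩ := mem_symbolicPower.1 hf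
  obtain ⟨v, hv, hvg⟩ := mem_symbolicPower.1 hg
  refine mem_symbolicPower.2 ⟨u * v, fun h => (Ideal.IsPrime.mem_or_mem ‹_› h).elim hu hv, ?_⟩
  rw [mul_mul_mul_comm, pow_add]
  exact Ideal.mul_mem_mul huf hvg

lemma list_prod_mem_symbolicPower {ι : Type*} (d : ι → ℕ) (f : ι → R)
    (h : ∀ i, f i ∈ symbolicPower I (d i)) (L : List ι) :
    (L.map f).prod ∈ symbolicPower I (L.map d).sum := by
  induction L with
  | nil =>
    exact mem_symbolicPower.2
      ⟨1, (Ideal.ne_top_iff_one I).1 (Ideal.IsPrime.ne_top ‹_›), by simp⟩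
  | cons i L ih =>
    simp only [List.map_cons, List.prod_cons, List.sum_cons]
    exact mul_mem_symbolicPower_add (h i) ih

end SymbolicPower

section LeftCountLemmas

variable {p q : ℕ}

lemma leftCount_eq_card (c : Fin p → Fin (q + p)) :
    leftCount c = (Finset.univ.filter fun l => (c l : ℕ) < q).card := by
  rw [leftCount, Finset.card_filter]
  refine Finset.sum_congr rfl fun l _ => ?_
  refine Fin.addCases (fun j => ?_) (fun j => ?_) (c l) <;> simp

lemma exists_castAdd_eq {j : Fin (q + p)} (h : (j : ℕ) < q) : ∃ i, Fin.castAdd p i = j :=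
  ⟨⟨j, h⟩, rfl⟩

lemma exists_natAdd_eq {j : Fin (q + p)} (h : ¬ (j : ℕ) < q) : ∃ i, Fin.natAdd q i = j :=
  ⟨⟨j - q, by omega⟩, Fin.ext (by simp; omega)⟩

lemma leftCount_update_natAdd {c : Fin p → Fin (q + p)} {l : Fin p} (h : (c l : ℕ) < q)
    (i : Fin p) : leftCount (Function.update c l (Fin.natAdd q i)) + 1 = leftCount c := by
  rw [leftCount_eq_card, leftCount_eq_card,
    ← Finset.card_erase_add_one (a := l) (s := Finset.univ.filter fun l => (c l : ℕ) < q)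
      (by simpa using h)]
  congr 2
  ext x
  by_cases hx : x = l
  · subst hx; simp
  · simp [hx]

lemma leftCount_update_of_not_lt {c : Fin p → Fin (q + p)} {l : Fin p} (h : ¬ (c l : ℕ) < q)
    {j : Fin (q + p)} (hj : (j : ℕ) < q) :
    leftCount (Function.update c l j) = leftCount c + 1 := by
  obtain ⟨i, hi⟩ := exists_natAdd_eq h
  rw [← leftCount_update_natAdd (c := Function.update c l j) (l := l) (by simpa using hj) i,
    Function.update_idem, hi, Function.update_eq_self]

end LeftCountLemmas

section Ideals

variable {k : Type*} [Field k] {p q : ℕ}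

lemma det_genericMatrix_mem {t : ℕ} (r : Fin t → Fin p) (c : Fin t → Fin q) :
    ((genericMatrix k p q).submatrix r c).det ∈ Ideal.span (genericMinors k p q t) := by
  by_cases hr : Function.Injective r
  · by_cases hc : Function.Injective c
    · exact Ideal.subset_span ⟨r, c, hr, hc, rfl⟩
    · simp only [Function.Injective, not_forall] at hc
      obtain ⟨a, b, hab, hne⟩ := hc
      rw [Matrix.det_zero_of_column_eq hne fun i => by simp [hab]]
      exact zero_mem _
  · simp only [Function.Injective, not_forall] at hr
    obtain ⟨a, b, hab, hne⟩ := hr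
    rw [Matrix.det_zero_of_row_eq hne (by ext j; simp [hab])]
    exact zero_mem _

lemma maxMinor_augment_mem {t : ℕ} {c : Fin p → Fin (q + p)} (h : t ≤ leftCount c) :
    maxMinor (augment (genericMatrix k p q)) c ∈ Ideal.span (genericMinors k p q t) := by
  rw [leftCount_eq_card] at h
  obtain ⟨T, hT, hTc⟩ := Finset.exists_subset_card_eq h
  have hlt (b : Fin t) : (c (T.orderEmbOfFin hTc b) : ℕ) < q := by
    simpa using hT (T.orderEmbOfFin_mem hTc b)
  choose γ hγ using fun b => exists_castAdd_eq (hlt b)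
  refine det_mem_of_minors_mem det_genericMatrix_mem _ (T.orderEmbOfFin hTc).injective id γ
    fun i b => ?_
  rw [Matrix.submatrix_apply, ← hγ, augment_castAdd]

lemma minors_le_orderIdeal {s : ℕ} (hs : s + 1 ≤ p) :
    Ideal.span (genericMinors k p q (s + 1)) ≤ orderIdeal k p q s 1 := by
  rw [Ideal.span_le]
  rintro _ ⟨r, c, -, -, rfl⟩
  rw [SetLike.mem_coe, mem_orderIdeal, pow_one, Polynomial.X_dvd_iff,
    Polynomial.coeff_zero_eq_eval_zero]
  let χ := (Polynomial.evalRingHom (0 : MvPolynomial (Fin (q + p) ×ₗ Fin p) k)).comp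
    (weightHom k (lowerLeft p q s))
  let φ := χ.comp (cramerHom k p q).toRingHom
  have h1 : (genericMatrix k p q).map φ = cramerMatrix ((genericWide k p q).map χ) := by
    rw [cramerMatrix_map, ← genericMatrix_map_cramerHom]
    rfl
  change φ ((genericMatrix k p q).submatrix r c).det = 0
  rw [φ.map_det]
  change (((genericMatrix k p q).map φ).submatrix r c).det = 0
  rw [h1, cramerMatrix]
  refine det_mul_submatrix_eq_zero hs _ _ (fun i j hi => ?_) r c
  simp [leftBlock, χ, genericWide, weightHom, lowerLeft, hi]

lemma orderIdeal_one_le {s : ℕ} (hs : s + 1 ≤ p) :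
    orderIdeal k p q s 1 ≤ Ideal.span (genericMinors k p q (s + 1)) := by
  refine orderIdeal_le (by omega) (by omega) _ fun L _ hL => ?_
  obtain ⟨c, hc, hc'⟩ : ∃ c ∈ L, excess s c ≠ 0 := by
    by_contra! h
    rw [List.sum_eq_zero (by simpa using h)] at hL
    omega
  rw [excess] at hc'
  exact Ideal.mem_of_dvd _ (List.dvd_prod (List.mem_map_of_mem hc))
    (maxMinor_augment_mem (by omega))

lemma orderIdeal_one {s : ℕ} (hs : s + 1 ≤ p) :
    orderIdeal k p q s 1 = Ideal.span (genericMinors k p q (s + 1)) :=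
  le_antisymm (orderIdeal_one_le hs) (minors_le_orderIdeal hs)

theorem isPrime_span_genericMinors {s : ℕ} (hs : s + 1 ≤ p) :
    (Ideal.span (genericMinors k p q (s + 1))).IsPrime := by
  rw [← orderIdeal_one hs, orderIdeal, pow_one]
  have : (Ideal.span {(Polynomial.X : Polynomial (MvPolynomial (Fin (q + p) ×ₗ Fin p) k))}).IsPrime :=
    (Ideal.span_singleton_prime Polynomial.X_ne_zero).2 Polynomial.prime_X
  exact Ideal.comap_isPrime _ _

lemma pow_le_orderIdeal {s : ℕ} (hs : s + 1 ≤ p) (m : ℕ) :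
    Ideal.span (genericMinors k p q (s + 1)) ^ m ≤ orderIdeal k p q s m := by
  rw [← orderIdeal_one hs, orderIdeal, orderIdeal, pow_one, ← Ideal.span_singleton_pow]
  exact Ideal.le_comap_pow _ _

lemma symbolicPower_le_orderIdeal {s : ℕ} (hs : s + 1 ≤ p) (m : ℕ) :
    symbolicPower (Ideal.span (genericMinors k p q (s + 1))) m ≤ orderIdeal k p q s m := by
  have := isPrime_span_genericMinors (k := k) (q := q) hs
  intro f hf
  obtain ⟨u, hu, huf⟩ := mem_symbolicPower.1 hf
  replace huf := pow_le_orderIdeal hs m huf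
  rw [← orderIdeal_one hs, mem_orderIdeal, pow_one] at hu
  rw [mem_orderIdeal, map_mul, map_mul] at huf
  exact mem_orderIdeal.2 (Polynomial.prime_X.pow_dvd_of_dvd_mul_left m hu huf)

/-- A maximal minor of `[X | 1]` using less than `t` columns of `X` is not in the ideal of
`t`-minors. -/
lemma maxMinor_augment_notMem {t : ℕ} {a : Fin p → Fin (q + p)} (ha : Function.Injective a)
    (π : Equiv.Perm (Fin p)) (hπ : ∀ l i, a l = Fin.natAdd q i → i = π l)
    (h : leftCount a < t) :
    maxMinor (augment (genericMatrix k p q)) a ∉ Ideal.span (genericMinors k p q t) := by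
  classical
  let M : Matrix (Fin p) (Fin q) k :=
    Matrix.of fun i j => if a (π.symm i) = Fin.castAdd p j then 1 else 0
  let φ : MvPolynomial (Fin p × Fin q) k →+* k := MvPolynomial.eval fun v => M v.1 v.2
  have hM : (genericMatrix k p q).map φ = M := by
    ext i j
    simp [genericMatrix, φ]
  have h0 : Ideal.span (genericMinors k p q t) ≤ RingHom.ker φ := by
    rw [Ideal.span_le]
    rintro _ ⟨r, c, -, hc, rfl⟩
    change φ ((genericMatrix k p q).submatrix r c).det = 0
    rw [φ.map_det]
    change (((genericMatrix k p q).map φ).submatrix r c).det = 0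
    rw [hM]
    obtain ⟨b, hb⟩ : ∃ b, ∀ l, a l ≠ Fin.castAdd p (c b) := by
      by_contra! hcon
      choose e he using hcon
      refine h.not_ge ?_
      rw [leftCount_eq_card]
      calc t = (Finset.univ : Finset (Fin t)).card := by simp
        _ ≤ _ := Finset.card_le_card_of_injOn e (fun b _ => by simp [he]) fun b _ b' _ hbb =>
          hc (Fin.castAdd_injective q p (by rw [← he, ← he, hbb]))
    exact Matrix.det_eq_zero_of_column_eq_zero b fun i => if_neg (hb _)
  intro hmem
  have h1 : φ (maxMinor (augment (genericMatrix k p q)) a) = 0 := h0 hmem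
  rw [← maxMinor_map, ← augment_map, hM, maxMinor] at h1
  have h2 : (augment M).submatrix id a = (1 : Matrix (Fin p) (Fin p) k).submatrix π.symm id := by
    ext i l
    simp only [Matrix.submatrix_apply, id, Matrix.one_apply]
    by_cases hl : (a l : ℕ) < q
    · obtain ⟨j, hj⟩ := exists_castAdd_eq hl
      rw [← hj, augment_castAdd]
      change (if _ then _ else _) = _
      rw [hj]
      exact if_congr ha.eq_iff rfl rfl
    · obtain ⟨j, hj⟩ := exists_natAdd_eq hl
      rw [← hj, augment_natAdd, hπ l j hj.symm, Matrix.one_apply]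
      exact if_congr (Equiv.symm_apply_eq π).symm rfl rfl
  rw [h2, Matrix.det_permute, Matrix.det_one, mul_one] at h1
  rcases Int.units_eq_one_or (Equiv.Perm.sign π.symm) with h3 | h3 <;> rw [h3] at h1 <;> simp at h1

end Ideals

section Containment

variable {k : Type*} [Field k] {p q : ℕ}

/-- Maximal minors on columns `c` lie in the symbolic power given by the excess of `c`. -/
theorem maxMinor_augment_mem_symbolicPower {s : ℕ} (hs : s + 1 ≤ p) (c : Fin p → Fin (q + p)) :
    maxMinor (augment (genericMatrix k p q)) c ∈
      symbolicPower (Ideal.span (genericMinors k p q (s + 1))) (excess s c) := by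
  classical
  have hI := isPrime_span_genericMinors (k := k) (q := q) hs
  set I := Ideal.span (genericMinors k p q (s + 1)) with hIdef
  by_cases hc : Function.Injective c
  swap
  · simp only [Function.Injective, not_forall] at hc
    obtain ⟨l, l', hll, hne⟩ := hc
    rw [maxMinor, Matrix.det_zero_of_column_eq hne fun i => by simp [hll]]
    exact zero_mem _
  set P := Finset.univ.filter fun l => (c l : ℕ) < q with hP
  obtain ⟨T, hTP, hT⟩ := Finset.exists_subset_card_eq (s := P) (n := excess s c)
    ((Nat.sub_le _ _).trans_eq (leftCount_eq_card c))
  have hTlt {l} (hl : l ∈ T) : (c l : ℕ) < q := by simpa [hP] using hTP hl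
  obtain ⟨π, hπ⟩ : ∃ π : Equiv.Perm (Fin p), ∀ l i, c l = Fin.natAdd q i → i = π l := by
    choose! r hr using fun l (hl : ¬ (c l : ℕ) < q) => exists_natAdd_eq hl
    obtain ⟨g, hg⟩ := Finset.exists_equiv_extend_of_card_eq (t := (Finset.univ : Finset (Fin p)))
      (s := Pᶜ) (f := r) (by simp) (Finset.subset_univ _) fun l hl l' hl' h => hc (by
        rw [← hr l (by simpa [hP] using hl), ← hr l' (by simpa [hP] using hl'), h])
    refine ⟨g.trans (Equiv.subtypeUnivEquiv fun x => Finset.mem_univ x), fun l i hl => ?_⟩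
    have hlq : ¬ (c l : ℕ) < q := by rw [hl]; simp
    change i = (g l : Fin p)
    rw [hg l (by simpa [hP] using hlq)]
    exact Fin.natAdd_injective p q (by rw [hr l hlq, hl])
  let a : Fin p → Fin (q + p) := fun l => if l ∈ T then Fin.natAdd q (π l) else c l
  have haπ : ∀ l i, a l = Fin.natAdd q i → i = π l := by
    intro l i hl
    by_cases h : l ∈ T
    · simp only [a, if_pos h] at hl
      exact (Fin.natAdd_injective p q hl).symm
    · simp only [a, if_neg h] at hl
      exact hπ l i hl
  have hainj : Function.Injective a := by
    intro l l' h
    by_cases hl : ((a l : Fin (q + p)) : ℕ) < q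
    · have h1 : l ∉ T := fun h' => by simp [a, h'] at hl
      have h2 : l' ∉ T := fun h' => by rw [h] at hl; simp [a, h'] at hl
      simp only [a, if_neg h1, if_neg h2] at h
      exact hc h
    · obtain ⟨i, hi⟩ := exists_natAdd_eq hl
      exact π.injective ((haπ l i hi.symm).symm.trans (haπ l' i (h.symm.trans hi.symm)))
  have hacount : leftCount a + excess s c = leftCount c := by
    rw [leftCount_eq_card, leftCount_eq_card, ← hT, ← Finset.card_sdiff_add_card_eq_card hTP]
    congr 2
    ext l
    by_cases h : l ∈ T <;> simp [a, h, hP]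
  by_cases hex : excess s c = 0
  · rw [hex]
    exact mem_symbolicPower.2 ⟨1, (Ideal.ne_top_iff_one I).1 hI.ne_top, by simp⟩
  have hacount' : leftCount a = s := by
    rw [excess] at hex hacount
    omega
  set X := augment (genericMatrix k p q) with hX
  refine mem_symbolicPower.2 ⟨maxMinor X a ^ (p - 1), fun h =>
    maxMinor_augment_notMem hainj π haπ (by omega) (hI.mem_of_pow_mem _ h), ?_⟩
  have hentry (l' l : Fin p) : ((X.submatrix id a).adjugate * X.submatrix id c) l' l =
      maxMinor X (Function.update a l' (c l)) := by
    change ((X.submatrix id a).adjugate.mulVec fun i => X i (c l)) l' = _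
    rw [← Matrix.cramer_eq_adjugate_mulVec, Matrix.cramer_apply, maxMinor]
    congr 1
    ext i j
    by_cases hj : j = l'
    · subst hj; simp
    · simp [hj]
  have hdet := det_mem_pow_card (J := I) ((X.submatrix id a).adjugate * X.submatrix id c) T
    (fun l' l hl hne => ?_) fun l' hl' l hl => ?_
  · rw [Matrix.det_mul, Matrix.det_adjugate, Fintype.card_fin, hT] at hdet
    exact hdet
  · rw [hentry, maxMinor]
    refine Matrix.det_zero_of_column_eq hne fun i => ?_
    simp [a, hl, hne.symm]
  · rw [hentry]
    refine maxMinor_augment_mem ?_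
    rw [leftCount_update_of_not_lt (by simp [a, hl']) (hTlt hl)]
    omega

/-- Expansion along a column of `X`. -/
lemma maxMinor_augment_expand (c : Fin p → Fin (q + p)) {l : Fin p} {j : Fin q}
    (hj : Fin.castAdd p j = c l) :
    maxMinor (augment (genericMatrix k p q)) c = ∑ i, MvPolynomial.X (i, j) *
      maxMinor (augment (genericMatrix k p q)) (Function.update c l (Fin.natAdd q i)) := by
  rw [maxMinor, Matrix.det_eq_sum_mul_adjugate_col _ l]
  refine Finset.sum_congr rfl fun i _ => ?_
  congr 1
  · rw [Matrix.submatrix_apply, ← hj, augment_castAdd]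
    rfl
  · rw [← Matrix.col_apply (Matrix.adjugate _), ← Matrix.mulVec_single_one,
      ← Matrix.cramer_eq_adjugate_mulVec, Matrix.cramer_apply, maxMinor]
    congr 1
    ext i' l'
    by_cases h : l' = l
    · subst h
      simp [augment_natAdd, Matrix.one_apply, Pi.single_apply]
    · simp [h]

lemma maxMinor_augment_mem_mul {s : ℕ} (hs : s + 1 ≤ p) {c : Fin p → Fin (q + p)}
    (hc : excess s c ≠ 0) :
    maxMinor (augment (genericMatrix k p q)) c ∈
      Ideal.span (Set.range (MvPolynomial.X : Fin p × Fin q → MvPolynomial (Fin p × Fin q) k)) *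
        symbolicPower (Ideal.span (genericMinors k p q (s + 1))) (excess s c - 1) := by
  rw [excess] at hc
  obtain ⟨l, hl⟩ : ∃ l, (c l : ℕ) < q := by
    by_contra! h
    rw [leftCount_eq_card, Finset.filter_false_of_mem fun l _ => (h l).not_gt] at hc
    simp at hc
  obtain ⟨j, hj⟩ := exists_castAdd_eq hl
  rw [maxMinor_augment_expand c hj]
  refine Ideal.sum_mem _ fun i _ => Ideal.mul_mem_mul (Ideal.subset_span ⟨_, rfl⟩) ?_
  convert maxMinor_augment_mem_symbolicPower hs _ using 2
  have := leftCount_update_natAdd hl i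
  simp only [excess]
  omega

theorem symbolicPower_succ_le {s : ℕ} (hs : s + 1 ≤ p) (m : ℕ) :
    symbolicPower (Ideal.span (genericMinors k p q (s + 1))) (m + 1) ≤
      Ideal.span (Set.range (MvPolynomial.X : Fin p × Fin q → MvPolynomial (Fin p × Fin q) k)) *
        symbolicPower (Ideal.span (genericMinors k p q (s + 1))) m := by
  have hI := isPrime_span_genericMinors (k := k) (q := q) hs
  refine (symbolicPower_le_orderIdeal hs _).trans
    (orderIdeal_le (by omega) (by omega) _ fun L _ hL => ?_)
  obtain ⟨c, hc, hc'⟩ : ∃ c ∈ L, excess s c ≠ 0 := by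
    by_contra! h
    rw [List.sum_eq_zero (by simpa using h)] at hL
    omega
  have hperm := List.perm_cons_erase hc
  rw [(hperm.map _).sum_eq, List.map_cons, List.sum_cons] at hL
  rw [(hperm.map _).prod_eq, List.map_cons, List.prod_cons]
  have h1 := list_prod_mem_symbolicPower (I := Ideal.span (genericMinors k p q (s + 1)))
    (excess s) _ (maxMinor_augment_mem_symbolicPower hs) (L.erase c)
  have h2 := Ideal.mul_mem_mul (maxMinor_augment_mem_mul (k := k) hs hc') h1
  rw [mul_assoc] at h2
  refine Ideal.mul_mono_right (Ideal.mul_le.2 fun f hf g hg => ?_) h2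
  exact symbolicPower_antitone (by omega) (mul_mem_symbolicPower_add hf hg)

end Containment

end GenericMinors

/-- For the generic determinantal ideal `I = I_t(X)` (any characteristic), one has
`I^{(m+1)} ⊆ 𝔪 I^{(m)}` for every `m ≥ 1`, and consequently
`I^{(m+c−1)} ⊆ 𝔪^{c−1} I^{(m)}` for all `c ≥ 1`. -/
theorem stmt_15 {k : Type*} [Field k] (p q t : ℕ) (ht : 1 ≤ t) (htp : t ≤ p) (htq : t ≤ q) :
    ∀ m : ℕ, 1 ≤ m →
      (symbolicPower (Ideal.span (genericMinors k p q t)) (m + 1) ≤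
        (Ideal.span (Set.range
            (MvPolynomial.X : Fin p × Fin q → MvPolynomial (Fin p × Fin q) k))) *
          symbolicPower (Ideal.span (genericMinors k p q t)) m) ∧
      (∀ c : ℕ, 1 ≤ c →
        symbolicPower (Ideal.span (genericMinors k p q t)) (m + c - 1) ≤
          (Ideal.span (Set.range
              (MvPolynomial.X : Fin p × Fin q → MvPolynomial (Fin p × Fin q) k))) ^ (c - 1) *
            symbolicPower (Ideal.span (genericMinors k p q t)) m) := by
  obtain ⟨s, rfl⟩ := Nat.exists_eq_add_of_le' ht
  intro m _
  refine ⟨GenericMinors.symbolicPower_succ_le htp m, fun c hc => ?_⟩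
  obtain ⟨c, rfl⟩ := Nat.exists_eq_add_of_le' hc
  induction c with
  | zero => simp
  | succ c ih =>
    refine (GenericMinors.symbolicPower_succ_le htp (m + c)).trans ?_
    rw [Nat.add_sub_cancel, pow_succ', mul_assoc]
    exact Ideal.mul_mono_right (ih (Nat.le_add_left 1 c))
end
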